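/- arXiv:0810.0801 — 8 statements merged into one kernel-verified Lean document; each statement's English description precedes it below -/
import Mathlib

section
/- Let G be a finite simple graph on n vertices with m edges such that 2m ≥ n. Then E(G) ≤ 2m/n + sqrt((n−1)·(2m − (2m/n)²)). -/
open Real Filter SimpleGraph

/-- The adjacency matrix of a simple graph over `ℝ` is Hermitian (it is symmetric). -/
lemma adjMatrix_isHermitian {V : Type*} [Fintype V] [DecidableEq V]
    (G : SimpleGraph V) [DecidableRel G.Adj] : (G.adjMatrix ℝ).IsHermitian := by
  unfold Matrix.IsHermitian
  rw [Matrix.conjTranspose_eq_transpose_of_trivial]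
  exact G.isSymm_adjMatrix

/-- The eigenvalues (with multiplicity, indexed by the vertices) of the adjacency
matrix of a finite simple graph, regarded as a real symmetric matrix. -/
noncomputable def graphEigenvalues {V : Type*} [Fintype V] [DecidableEq V]
    (G : SimpleGraph V) : V → ℝ :=
  letI := Classical.decRel G.Adj
  (adjMatrix_isHermitian G).eigenvalues

/-- The energy of a finite simple graph: the sum of the absolute values of the
eigenvalues (with multiplicity) of its adjacency matrix. -/
noncomputable def graphEnergy {V : Type*} [Fintype V] [DecidableEq V]
    (G : SimpleGraph V) : ℝ :=
  ∑ v, |graphEigenvalues G v|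

/-- The trace of the square of a Hermitian matrix is the sum of its squared eigenvalues. -/
lemma Matrix.IsHermitian.sum_sq_eigenvalues {n : Type*} [Fintype n] [DecidableEq n]
    {A : Matrix n n ℝ} (hA : A.IsHermitian) :
    ∑ i, hA.eigenvalues i ^ 2 = (A * A).trace := by
  conv_rhs => rw [hA.spectral_theorem, ← map_mul, Unitary.conjStarAlgAut_apply,
    Matrix.trace_mul_comm, ← mul_assoc]
  simp [Matrix.trace, sq]

open scoped Matrix in
/-- The quadratic form of a real symmetric matrix is at most an upper bound of its
eigenvalues times the squared length. -/
lemma Matrix.IsHermitian.mulVec_dotProduct_le {n : Type*} [Fintype n] [DecidableEq n]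
    {A : Matrix n n ℝ} (hA : A.IsHermitian) {c : ℝ} (hc : ∀ i, hA.eigenvalues i ≤ c)
    (x : n → ℝ) : (A *ᵥ x) ⬝ᵥ x ≤ c * (x ⬝ᵥ x) := by
  set b := hA.eigenvectorBasis
  have hcoord (i : n) : (A *ᵥ x) ⬝ᵥ ⇑(b i) = hA.eigenvalues i * (x ⬝ᵥ ⇑(b i)) := by
    have hT : Aᵀ = A := by simpa using hA.eq
    rw [dotProduct_comm, Matrix.dotProduct_mulVec, ← Matrix.mulVec_transpose, hT,
      hA.mulVec_eigenvectorBasis, smul_dotProduct, smul_eq_mul, dotProduct_comm x]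
  have hparseval (y z : n → ℝ) : y ⬝ᵥ z = ∑ i, (y ⬝ᵥ ⇑(b i)) * (z ⬝ᵥ ⇑(b i)) := by
    have h := b.sum_inner_mul_inner (WithLp.toLp 2 y) (WithLp.toLp 2 z)
    simp only [EuclideanSpace.inner_eq_star_dotProduct, star_trivial] at h
    rw [dotProduct_comm y z, ← h]
    exact Finset.sum_congr rfl fun i _ ↦ by rw [dotProduct_comm y]
  rw [hparseval, hparseval x x, Finset.mul_sum]
  refine Finset.sum_le_sum fun i _ ↦ ?_
  rw [hcoord, mul_assoc]
  exact mul_le_mul_of_nonneg_right (hc i) (mul_self_nonneg _)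

/-- The eigenvalues of a graph do not depend on the choice of decidability instance. -/
lemma graphEigenvalues_eq {V : Type*} [Fintype V] [DecidableEq V]
    (G : SimpleGraph V) [DecidableRel G.Adj] :
    graphEigenvalues G = (adjMatrix_isHermitian G).eigenvalues := by
  unfold graphEigenvalues
  congr!

/-- The squared eigenvalues of a graph sum to twice its number of edges. -/
lemma sum_sq_graphEigenvalues {V : Type*} [Fintype V] [DecidableEq V]
    (G : SimpleGraph V) [DecidableRel G.Adj] :
    ∑ v, graphEigenvalues G v ^ 2 = 2 * (G.edgeFinset.card : ℝ) := by
  rw [graphEigenvalues_eq, Matrix.IsHermitian.sum_sq_eigenvalues, Matrix.trace]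
  simp only [Matrix.diag_apply, adjMatrix_mul_self_apply_self]
  exact_mod_cast G.sum_degrees_eq_twice_card_edges

/-- Some eigenvalue of a graph is at least the average degree. -/
lemma exists_averageDegree_le_graphEigenvalues {V : Type*} [Fintype V] [DecidableEq V]
    [Nonempty V] (G : SimpleGraph V) [DecidableRel G.Adj] :
    ∃ v, 2 * (G.edgeFinset.card : ℝ) / (Fintype.card V : ℝ) ≤ graphEigenvalues G v := by
  obtain ⟨v, hv⟩ := Finite.exists_max (graphEigenvalues G)
  refine ⟨v, ?_⟩
  rw [div_le_iff₀ (by exact_mod_cast Fintype.card_pos)]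
  have hle : dotProduct ((G.adjMatrix ℝ).mulVec 1) 1 ≤
      graphEigenvalues G v * dotProduct 1 (1 : V → ℝ) :=
    Matrix.IsHermitian.mulVec_dotProduct_le (adjMatrix_isHermitian G)
      (fun i ↦ by simpa only [graphEigenvalues_eq] using hv i) 1
  rw [← natCast_card_dart_eq_dotProduct, G.dart_card_eq_twice_card_edges] at hle
  simpa using hle

/-- If `x + s` is maximized subject to `s ^ 2 ≤ k * (N - x ^ 2)` and `x ≥ a`, where `a` is
past the unconstrained maximum, the maximum is attained at `x = a`. -/
lemma add_le_add_sqrt_of_sq_le {k N a x s : ℝ} (hk : 1 ≤ k) (ha : 0 ≤ a)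
    (hN : N ≤ (k + 1) * a ^ 2) (hax : a ≤ x) (hs : s ^ 2 ≤ k * (N - x ^ 2)) :
    x + s ≤ a + √(k * (N - a ^ 2)) := by
  have hmono : k * (N - x ^ 2) ≤ k * (N - a ^ 2) := by gcongr
  have hD0 : 0 ≤ k * (N - a ^ 2) := (sq_nonneg s).trans (hs.trans hmono)
  set D := √(k * (N - a ^ 2))
  have hD : 0 ≤ D := Real.sqrt_nonneg _
  have hDsq : D ^ 2 = k * (N - a ^ 2) := Real.sq_sqrt hD0
  have hsD : s ≤ D := Real.le_sqrt_of_sq_le (hs.trans hmono)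
  have hDka : D ≤ k * a := by
    refine abs_le_of_sq_le_sq' ?_ (by positivity) |>.2
    rw [hDsq]
    nlinarith
  have hsum : s + (x - a) ≤ D := by
    refine abs_le_of_sq_le_sq' ?_ hD |>.2
    nlinarith [mul_nonneg (sub_nonneg.2 hax) (sub_nonneg.2 hsD),
      mul_nonneg (sub_nonneg.2 hax) (sub_nonneg.2 hDka),
      mul_nonneg (sub_nonneg.2 hk) (sq_nonneg (x - a))]
  linarith

/-- Koolen–Moulton bound: if `G` has `n` vertices and `m` edges with
`2m ≥ n`, then `E(G) ≤ 2m/n + sqrt((n−1)(2m − (2m/n)²))`. -/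
theorem energy_le_koolen_moulton {V : Type*} [Fintype V] [DecidableEq V]
    (G : SimpleGraph V) [DecidableRel G.Adj]
    (h : 2 * G.edgeFinset.card ≥ Fintype.card V) :
    graphEnergy G ≤
      2 * (G.edgeFinset.card : ℝ) / (Fintype.card V : ℝ) +
        Real.sqrt (((Fintype.card V : ℝ) - 1) *
          (2 * (G.edgeFinset.card : ℝ) -
            (2 * (G.edgeFinset.card : ℝ) / (Fintype.card V : ℝ)) ^ 2)) := by
  rcases isEmpty_or_nonempty V with hV | hV
  · rw [graphEnergy, Finset.univ_eq_empty, Finset.sum_empty]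
    positivity
  have hn : (0 : ℝ) < Fintype.card V := by exact_mod_cast Fintype.card_pos
  have hn2 : 2 ≤ Fintype.card V := by
    by_contra! hlt
    have hle := G.card_edgeFinset_le_card_choose_two
    rw [Nat.choose_eq_zero_of_lt hlt] at hle
    have := Fintype.card_pos (α := V)
    omega
  have hn2' : (2 : ℝ) ≤ Fintype.card V := by exact_mod_cast hn2
  obtain ⟨v, hv⟩ := exists_averageDegree_le_graphEigenvalues G
  have hsum := sum_sq_graphEigenvalues G
  have h' : (Fintype.card V : ℝ) ≤ 2 * (G.edgeFinset.card : ℝ) := by exact_mod_cast h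
  set n : ℝ := (Fintype.card V : ℝ)
  set N : ℝ := 2 * (G.edgeFinset.card : ℝ)
  have ha1 : 1 ≤ N / n := (one_le_div hn).2 h'
  have hNa : n * (N / n) = N := mul_div_cancel₀ N hn.ne'
  rw [← Finset.add_sum_erase _ _ (Finset.mem_univ v)] at hsum
  rw [graphEnergy, ← Finset.add_sum_erase _ _ (Finset.mem_univ v),
    abs_of_nonneg (by linarith : 0 ≤ graphEigenvalues G v)]
  refine add_le_add_sqrt_of_sq_le (by linarith) (by linarith) (by nlinarith) hv ?_
  calc _ ≤ _ := sq_sum_le_card_mul_sum_sq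
    _ = _ := by
      rw [Finset.card_erase_of_mem (Finset.mem_univ v), Finset.card_univ,
        Nat.cast_pred Fintype.card_pos, ← hsum]
      simp [n]
end

section
/- Let G be a finite simple graph and let H be an induced subgraph of G. Then E(G) − E(H) ≤ E(G − E(H)) ≤ E(G) + E(H), where G − E(H) is the spanning subgraph of G obtained by deleting from G all edges of H. -/
open Real Filter SimpleGraph

/-- The real spectral theorem in terms of an orthogonal matrix. -/
lemma Matrix.IsHermitian.exists_orthogonal_diagonalization {n : Type*} [Fintype n]
    [DecidableEq n] {A : Matrix n n ℝ} (hA : A.IsHermitian) :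
    ∃ U : Matrix n n ℝ, U.transpose * U = 1 ∧
      A = U * Matrix.diagonal hA.eigenvalues * U.transpose := by
  refine ⟨hA.eigenvectorUnitary, ?_, ?_⟩
  · have h := Unitary.coe_star_mul_self hA.eigenvectorUnitary
    rwa [Matrix.star_eq_conjTranspose, Matrix.conjTranspose_eq_transpose_of_trivial] at h
  · have h := hA.spectral_theorem
    rw [Unitary.conjStarAlgAut_apply, Matrix.star_eq_conjTranspose,
      Matrix.conjTranspose_eq_transpose_of_trivial] at h
    exact h

/-- Any expansion of a real symmetric matrix as a combination of rank-one projections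
`R D Rᵀ` (unit columns, not necessarily orthogonal) has at least as large an `ℓ¹` norm of
coefficients as the spectral one. -/
lemma sum_abs_eigenvalues_le {n ι : Type*} [Fintype n] [DecidableEq n] [Fintype ι]
    [DecidableEq ι] {X : Matrix n n ℝ} (hX : X.IsHermitian) (d : ι → ℝ) (R : Matrix n ι ℝ)
    (hR : ∀ i, (R.transpose * R) i i = 1)
    (h : X = R * Matrix.diagonal d * R.transpose) :
    ∑ j, |hX.eigenvalues j| ≤ ∑ i, |d i| := by
  obtain ⟨U, hUU, hspec⟩ := hX.exists_orthogonal_diagonalization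
  have hUU' : U * U.transpose = 1 := mul_eq_one_comm.mp hUU
  set Y := U.transpose * R with hY
  have heig : ∀ j, hX.eigenvalues j = ∑ i, d i * Y j i ^ 2 := by
    intro j
    have hdiag : Matrix.diagonal hX.eigenvalues = Y * Matrix.diagonal d * Y.transpose := by
      calc Matrix.diagonal hX.eigenvalues
          = (U.transpose * U) * Matrix.diagonal hX.eigenvalues * (U.transpose * U) := by
            rw [hUU, Matrix.one_mul, Matrix.mul_one]
        _ = U.transpose * (U * Matrix.diagonal hX.eigenvalues * U.transpose) * U := by
            simp only [Matrix.mul_assoc]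
        _ = Y * Matrix.diagonal d * Y.transpose := by
            rw [← hspec, h, hY]
            simp only [Matrix.transpose_mul, Matrix.transpose_transpose, Matrix.mul_assoc]
    have hjj := congrFun (congrFun hdiag j) j
    rw [Matrix.diagonal_apply_eq, Matrix.mul_apply] at hjj
    rw [hjj]
    refine Finset.sum_congr rfl fun i _ => ?_
    rw [Matrix.mul_diagonal, Matrix.transpose_apply]
    ring
  have hcol : ∀ i, ∑ j, Y j i ^ 2 = 1 := by
    intro i
    have hYY : Y.transpose * Y = R.transpose * R := by
      calc Y.transpose * Y = R.transpose * (U * U.transpose) * R := by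
            simp only [hY, Matrix.transpose_mul, Matrix.transpose_transpose, Matrix.mul_assoc]
        _ = R.transpose * R := by rw [hUU', Matrix.mul_one]
    rw [← hR i, ← hYY, Matrix.mul_apply]
    exact Finset.sum_congr rfl fun j _ => by rw [Matrix.transpose_apply, sq]
  calc ∑ j, |hX.eigenvalues j| ≤ ∑ j, ∑ i, |d i| * Y j i ^ 2 := by
        refine Finset.sum_le_sum fun j _ => ?_
        rw [heig j]
        refine (Finset.abs_sum_le_sum_abs _ _).trans_eq (Finset.sum_congr rfl fun i _ => ?_)
        rw [abs_mul, abs_sq]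
    _ = ∑ i, |d i| := by
        rw [Finset.sum_comm]
        exact Finset.sum_congr rfl fun i _ => by rw [← Finset.mul_sum, hcol, mul_one]

/-- Triangle inequality for the trace norm of `A + c Q M Qᵀ`, with `Q` an isometry. -/
lemma sum_abs_eigenvalues_add_smul_conj_le {n m : Type*} [Fintype n] [DecidableEq n]
    [Fintype m] [DecidableEq m] {X A : Matrix n n ℝ} {M : Matrix m m ℝ}
    (hX : X.IsHermitian) (hA : A.IsHermitian) (hM : M.IsHermitian) (Q : Matrix n m ℝ)
    (hQ : Q.transpose * Q = 1) (c : ℝ) (h : X = A + c • (Q * M * Q.transpose)) :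
    ∑ j, |hX.eigenvalues j| ≤
      ∑ j, |hA.eigenvalues j| + |c| * ∑ i, |hM.eigenvalues i| := by
  obtain ⟨U, hU, hAspec⟩ := hA.exists_orthogonal_diagonalization
  obtain ⟨W, hW, hMspec⟩ := hM.exists_orthogonal_diagonalization
  have hQW : (Q * W).transpose * (Q * W) = 1 := by
    calc (Q * W).transpose * (Q * W) = W.transpose * (Q.transpose * Q) * W := by
          simp only [Matrix.transpose_mul, Matrix.mul_assoc]
      _ = 1 := by rw [hQ, Matrix.mul_one, hW]
  have key := sum_abs_eigenvalues_le hX (Sum.elim hA.eigenvalues (c • hM.eigenvalues))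
    (Matrix.fromCols U (Q * W)) ?_ ?_
  · simpa [Fintype.sum_sum_type, abs_mul, Finset.mul_sum] using key
  · rw [Matrix.transpose_fromCols, Matrix.fromRows_mul_fromCols, hU, hQW]
    rintro (i | i) <;> simp
  · rw [h, ← Matrix.fromBlocks_diagonal, Matrix.transpose_fromCols,
      Matrix.fromCols_mul_fromBlocks, Matrix.fromCols_mul_fromRows, Matrix.diagonal_smul]
    nth_rewrite 1 [hAspec, hMspec]
    simp [Matrix.transpose_mul, Matrix.mul_assoc]

/-- The `0`-`1` matrix of the inclusion of a finset of indices. -/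
def finsetInclusionMatrix {V : Type*} [DecidableEq V] (s : Finset V) :
    Matrix V (↑s : Set V) ℝ :=
  (1 : Matrix V V ℝ).submatrix id Subtype.val

lemma finsetInclusionMatrix_transpose_mul_self {V : Type*} [Fintype V] [DecidableEq V]
    (s : Finset V) :
    (finsetInclusionMatrix s).transpose * finsetInclusionMatrix s = 1 := by
  ext i j
  simp [finsetInclusionMatrix, Matrix.mul_apply, Matrix.one_apply]

lemma finsetInclusionMatrix_conj_apply {V : Type*} [DecidableEq V] (s : Finset V)
    (A : Matrix V V ℝ) (M : Matrix (↑s : Set V) (↑s : Set V) ℝ) (hM : ∀ x y, M x y = A x y)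
    (u v : V) :
    (finsetInclusionMatrix s * M * (finsetInclusionMatrix s).transpose) u v =
      if u ∈ s ∧ v ∈ s then A u v else 0 := by
  have hcoe : ∀ f : V → ℝ, ∑ x : (↑s : Set V), f x = ∑ x ∈ s, f x := fun f =>
    Finset.sum_coe_sort s f
  simp only [finsetInclusionMatrix, Matrix.mul_apply, Matrix.submatrix_apply,
    Matrix.transpose_apply, Matrix.one_apply, id, hM]
  have hinner : ∀ y, ∑ x : (↑s : Set V), (if u = x then 1 else 0) * A x y =
      if u ∈ s then A u y else 0 := fun y => by
    rw [hcoe fun x => (if u = x then 1 else 0) * A x y]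
    simp
  simp only [hinner]
  rw [hcoe fun y => (if u ∈ s then A u y else 0) * (if v = y then 1 else 0)]
  by_cases hu : u ∈ s <;> simp [hu]

/-- Day–So: for an induced subgraph `H = G.induce s` of `G`,
`E(G) − E(H) ≤ E(G − E(H)) ≤ E(G) + E(H)`, where `G − E(H)` is the spanning
subgraph of `G` obtained by deleting all edges of `H` (the edges of `G` with
both endpoints in `s`). -/
theorem energy_deleteEdges_induced {V : Type*} [Fintype V] [DecidableEq V]
    (G : SimpleGraph V) (s : Finset V) :
    graphEnergy G - graphEnergy (G.induce ↑s) ≤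
        graphEnergy (SimpleGraph.fromRel fun u v => G.Adj u v ∧ ¬(u ∈ s ∧ v ∈ s)) ∧
      graphEnergy (SimpleGraph.fromRel fun u v => G.Adj u v ∧ ¬(u ∈ s ∧ v ∈ s)) ≤
        graphEnergy G + graphEnergy (G.induce ↑s) := by
  classical
  set K := SimpleGraph.fromRel fun u v => G.Adj u v ∧ ¬(u ∈ s ∧ v ∈ s) with hK
  let _ := Classical.decRel G.Adj
  let _ := Classical.decRel K.Adj
  let _ := Classical.decRel (G.induce (↑s : Set V)).Adj
  have hsplit : G.adjMatrix ℝ = K.adjMatrix ℝ +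
      finsetInclusionMatrix s * (G.induce (↑s : Set V)).adjMatrix ℝ *
        (finsetInclusionMatrix s).transpose := by
    ext u v
    have hadj : K.Adj u v ↔ G.Adj u v ∧ ¬(u ∈ s ∧ v ∈ s) := by
      rw [hK, SimpleGraph.fromRel_adj]
      constructor
      · rintro ⟨-, h | h⟩
        · exact h
        · exact ⟨h.1.symm, fun h' => h.2 h'.symm⟩
      · exact fun h => ⟨h.1.ne, Or.inl h⟩
    rw [Matrix.add_apply, finsetInclusionMatrix_conj_apply s (G.adjMatrix ℝ) _ fun x y => by
      simp [SimpleGraph.adjMatrix_apply]]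
    simp only [SimpleGraph.adjMatrix_apply, hadj]
    by_cases h1 : G.Adj u v <;> by_cases h2 : u ∈ s ∧ v ∈ s <;> simp [h1, h2]
  have hQ := finsetInclusionMatrix_transpose_mul_self s
  have hG := adjMatrix_isHermitian G
  have hKh := adjMatrix_isHermitian K
  have hH := adjMatrix_isHermitian (G.induce (↑s : Set V))
  constructor
  · have := sum_abs_eigenvalues_add_smul_conj_le hG hKh hH _ hQ 1 (by rw [one_smul, ← hsplit])
    rw [abs_one, one_mul] at this
    exact sub_le_iff_le_add.mpr this
  · have := sum_abs_eigenvalues_add_smul_conj_le hKh hG hH _ hQ (-1)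
      (by rw [hsplit, neg_one_smul, add_neg_cancel_right])
    rw [abs_neg, abs_one, one_mul] at this
    exact this
end

section
/- Let G be a finite simple graph and let H be any subgraph of G (i.e., the vertex set of H is a subset of that of G and every edge of H is an edge of G). Then |E(G) − E(H)| ≤ E(G − E(H)) ≤ E(G) + E(H), where G − E(H) is the graph on the vertex set of G whose edges are the edges of G not in H. -/
open Real Filter SimpleGraph

open scoped Matrix

/-- Parseval's identity for the eigenvector basis of a real symmetric matrix. -/
lemma sum_dotProduct_eigenvectorBasis_mul {n : Type*} [Fintype n] [DecidableEq n]
    {A : Matrix n n ℝ} (hA : A.IsHermitian) (x y : n → ℝ) :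
    ∑ k, ((hA.eigenvectorBasis k : n → ℝ) ⬝ᵥ x) * ((hA.eigenvectorBasis k : n → ℝ) ⬝ᵥ y) =
      x ⬝ᵥ y := by
  have h := hA.eigenvectorBasis.sum_inner_mul_inner (WithLp.toLp 2 x) (WithLp.toLp 2 y)
  simp only [EuclideanSpace.inner_eq_star_dotProduct, star_trivial] at h
  rw [dotProduct_comm x y, ← h]
  exact Finset.sum_congr rfl fun k _ => by
    rw [dotProduct_comm y]

/-- The quadratic form of a real symmetric matrix in spectral coordinates. -/
lemma dotProduct_mulVec_eq_sum_eigenvalues {n : Type*} [Fintype n] [DecidableEq n]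
    {A : Matrix n n ℝ} (hA : A.IsHermitian) (x : n → ℝ) :
    x ⬝ᵥ A *ᵥ x =
      ∑ k, hA.eigenvalues k * ((hA.eigenvectorBasis k : n → ℝ) ⬝ᵥ x) ^ 2 := by
  rw [← sum_dotProduct_eigenvectorBasis_mul hA]
  refine Finset.sum_congr rfl fun k _ => ?_
  have hT : Aᵀ = A := by simpa [Matrix.IsHermitian] using hA
  rw [Matrix.dotProduct_mulVec, ← Matrix.mulVec_transpose, hT, hA.mulVec_eigenvectorBasis,
    smul_dotProduct, smul_eq_mul]
  ring

/-- A Bessel family: the squared coefficients of every vector sum to at most its squared norm. -/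
def IsBesselFamily {ι n : Type*} [Fintype ι] [Fintype n] (w : ι → n → ℝ) : Prop :=
  ∀ x : n → ℝ, ∑ j, (w j ⬝ᵥ x) ^ 2 ≤ x ⬝ᵥ x

lemma isBesselFamily_eigenvectorBasis {n : Type*} [Fintype n] [DecidableEq n]
    {A : Matrix n n ℝ} (hA : A.IsHermitian) :
    IsBesselFamily fun k => (hA.eigenvectorBasis k : n → ℝ) := fun x => by
  simp only [pow_two]
  exact (sum_dotProduct_eigenvectorBasis_mul hA x x).le

/-- The values of the quadratic form along a Bessel family are dominated by the trace norm. -/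
lemma IsBesselFamily.sum_abs_dotProduct_mulVec_le {ι n : Type*} [Fintype ι] [Fintype n]
    [DecidableEq n] {w : ι → n → ℝ} (hw : IsBesselFamily w) {A : Matrix n n ℝ}
    (hA : A.IsHermitian) :
    ∑ j, |w j ⬝ᵥ A *ᵥ w j| ≤ ∑ k, |hA.eigenvalues k| := by
  calc ∑ j, |w j ⬝ᵥ A *ᵥ w j|
      ≤ ∑ j, ∑ k, |hA.eigenvalues k| * (w j ⬝ᵥ (hA.eigenvectorBasis k : n → ℝ)) ^ 2 := by
        refine Finset.sum_le_sum fun j _ => ?_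
        rw [dotProduct_mulVec_eq_sum_eigenvalues hA]
        refine (Finset.abs_sum_le_sum_abs _ _).trans_eq (Finset.sum_congr rfl fun k _ => ?_)
        rw [abs_mul, abs_sq, dotProduct_comm]
    _ = ∑ k, |hA.eigenvalues k| * ∑ j, (w j ⬝ᵥ (hA.eigenvectorBasis k : n → ℝ)) ^ 2 := by
        rw [Finset.sum_comm]
        simp only [Finset.mul_sum]
    _ ≤ ∑ k, |hA.eigenvalues k| := by
        refine Finset.sum_le_sum fun k _ => mul_le_of_le_one_right (abs_nonneg _) ?_
        refine (hw _).trans_eq ?_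
        have h := hA.eigenvectorBasis.inner_eq_one k
        rwa [EuclideanSpace.inner_eq_star_dotProduct, star_trivial] at h

lemma sum_abs_eigenvectorBasis_dotProduct_mulVec {n : Type*} [Fintype n] [DecidableEq n]
    {A : Matrix n n ℝ} (hA : A.IsHermitian) :
    ∑ k, |(hA.eigenvectorBasis k : n → ℝ) ⬝ᵥ A *ᵥ (hA.eigenvectorBasis k : n → ℝ)| =
      ∑ k, |hA.eigenvalues k| := by
  refine Finset.sum_congr rfl fun k _ => ?_
  have h := hA.eigenvectorBasis.inner_eq_one k
  rw [EuclideanSpace.inner_eq_star_dotProduct, star_trivial] at h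
  rw [hA.mulVec_eigenvectorBasis, dotProduct_smul, h, smul_eq_mul, mul_one]

lemma graphEnergy_eq_sum_abs_eigenvalues {V : Type*} [Fintype V] [DecidableEq V]
    (G : SimpleGraph V) [inst : DecidableRel G.Adj] :
    graphEnergy G = ∑ v, |(adjMatrix_isHermitian G).eigenvalues v| := by
  obtain rfl : inst = Classical.decRel G.Adj := Subsingleton.elim _ _
  rfl

lemma exists_isBesselFamily_graphEnergy_eq {V : Type*} [Fintype V] [DecidableEq V]
    (G : SimpleGraph V) [DecidableRel G.Adj] :
    ∃ w : V → V → ℝ, IsBesselFamily w ∧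
      graphEnergy G = ∑ v, |w v ⬝ᵥ G.adjMatrix ℝ *ᵥ w v| :=
  ⟨_, isBesselFamily_eigenvectorBasis (adjMatrix_isHermitian G), by
    rw [sum_abs_eigenvectorBasis_dotProduct_mulVec, graphEnergy_eq_sum_abs_eigenvalues]⟩

lemma IsBesselFamily.sum_abs_le_graphEnergy {ι V : Type*} [Fintype ι] [Fintype V]
    [DecidableEq V] {w : ι → V → ℝ} (hw : IsBesselFamily w) (G : SimpleGraph V)
    [DecidableRel G.Adj] :
    ∑ j, |w j ⬝ᵥ G.adjMatrix ℝ *ᵥ w j| ≤ graphEnergy G := by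
  rw [graphEnergy_eq_sum_abs_eigenvalues]
  exact hw.sum_abs_dotProduct_mulVec_le _

/-- Extension by zero of a vector indexed by a finset. -/
def extendZero {V : Type*} [DecidableEq V] (s : Finset V) (x : s → ℝ) : V → ℝ :=
  fun v => if h : v ∈ s then x ⟨v, h⟩ else 0

lemma extendZero_coe {V : Type*} [DecidableEq V] {s : Finset V} (x : s → ℝ) (u : s) :
    extendZero s x u = x u := by
  simp [extendZero]

lemma extendZero_dotProduct {V : Type*} [Fintype V] [DecidableEq V] {s : Finset V}
    (x : s → ℝ) (y : V → ℝ) : extendZero s x ⬝ᵥ y = x ⬝ᵥ fun u : s => y u := by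
  have h : ∑ v ∈ s, extendZero s x v * y v = ∑ v, extendZero s x v * y v :=
    Finset.sum_subset (Finset.subset_univ s) fun v _ hv => by simp [extendZero, hv]
  rw [dotProduct, ← h, ← Finset.sum_coe_sort]
  simp only [extendZero_coe, dotProduct]

lemma IsBesselFamily.extendZero {ι V : Type*} [Fintype ι] [Fintype V] [DecidableEq V]
    {s : Finset V} {w : ι → s → ℝ} (hw : IsBesselFamily w) :
    IsBesselFamily fun j => extendZero s (w j) := fun x => by
  simp only [extendZero_dotProduct]
  refine (hw _).trans ?_
  simp only [dotProduct]
  rw [Finset.sum_coe_sort s fun v => x v * x v]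
  exact Finset.sum_le_sum_of_subset_of_nonneg (Finset.subset_univ s)
    fun v _ _ => mul_self_nonneg _

lemma IsBesselFamily.restrict {ι V : Type*} [Fintype ι] [Fintype V] [DecidableEq V]
    {s : Finset V} {w : ι → V → ℝ} (hw : IsBesselFamily w) :
    IsBesselFamily fun j => fun u : s => w j u := fun x => by
  have h := hw (_root_.extendZero s x)
  rw [extendZero_dotProduct] at h
  simp only [extendZero_coe] at h
  convert h using 3 with j
  rw [dotProduct_comm (w j), extendZero_dotProduct, dotProduct_comm]

/-- The adjacency form of a graph splits as the form of a subgraph plus the form of the graph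
with the edges of that subgraph removed. -/
lemma dotProduct_adjMatrix_mulVec_eq_add {V : Type*} [Fintype V] [DecidableEq V]
    (G G' : SimpleGraph V) (s : Finset V) (H : SimpleGraph s)
    [DecidableRel G.Adj] [DecidableRel G'.Adj] [DecidableRel H.Adj]
    (hsub : ∀ u v : s, H.Adj u v → G.Adj u v)
    (hG' : ∀ u v, G'.Adj u v ↔
      G.Adj u v ∧ ∀ (hu : u ∈ s) (hv : v ∈ s), ¬ H.Adj ⟨u, hu⟩ ⟨v, hv⟩) (x : V → ℝ) :
    x ⬝ᵥ G.adjMatrix ℝ *ᵥ x = x ⬝ᵥ G'.adjMatrix ℝ *ᵥ x +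
      (fun u : s => x u) ⬝ᵥ H.adjMatrix ℝ *ᵥ fun u : s => x u := by
  have key : G.adjMatrix ℝ *ᵥ x = G'.adjMatrix ℝ *ᵥ x +
      extendZero s (H.adjMatrix ℝ *ᵥ fun u : s => x u) := by
    ext u
    have hrow (hu : u ∈ s) : (H.adjMatrix ℝ *ᵥ fun v : s => x v) ⟨u, hu⟩ =
        extendZero s (H.adjMatrix ℝ ⟨u, hu⟩) ⬝ᵥ x := (extendZero_dotProduct _ _).symm
    simp only [Pi.add_apply]
    rw [extendZero]
    split_ifs with hu
    · rw [hrow hu, Matrix.mulVec, Matrix.mulVec, ← add_dotProduct]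
      congr 1
      ext v
      by_cases hv : v ∈ s
      · have h := hsub ⟨u, hu⟩ ⟨v, hv⟩
        by_cases hH : H.Adj ⟨u, hu⟩ ⟨v, hv⟩
        · simp [extendZero, hG', hu, hv, hH, h hH]
        · simp [extendZero, hG', hu, hv, hH]
      · simp [extendZero, hG', hv]
    · rw [add_zero, Matrix.mulVec, Matrix.mulVec]
      congr 1
      ext v
      simp [hG', hu]
  rw [key, dotProduct_add, dotProduct_comm x (extendZero _ _), extendZero_dotProduct,
    dotProduct_comm (H.adjMatrix ℝ *ᵥ _)]

/-- for an arbitrary subgraph `H` of `G` (vertex set a subset `s` of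
the vertices of `G`, every edge of `H` an edge of `G`),
`|E(G) − E(H)| ≤ E(G − E(H)) ≤ E(G) + E(H)`, where `G − E(H)` is the graph on the
vertex set of `G` whose edges are the edges of `G` not in `H`. -/
theorem energy_deleteEdges_subgraph {V : Type*} [Fintype V] [DecidableEq V]
    (G : SimpleGraph V) (s : Finset V) (H : SimpleGraph ↥s)
    (hsub : ∀ u v : ↥s, H.Adj u v → G.Adj ↑u ↑v) :
    |graphEnergy G - graphEnergy H| ≤
        graphEnergy (SimpleGraph.fromRel fun u v =>
          G.Adj u v ∧ ∀ (hu : u ∈ s) (hv : v ∈ s), ¬ H.Adj ⟨u, hu⟩ ⟨v, hv⟩) ∧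
      graphEnergy (SimpleGraph.fromRel fun u v =>
          G.Adj u v ∧ ∀ (hu : u ∈ s) (hv : v ∈ s), ¬ H.Adj ⟨u, hu⟩ ⟨v, hv⟩) ≤
        graphEnergy G + graphEnergy H := by
  classical
  set G' : SimpleGraph V := SimpleGraph.fromRel fun u v =>
    G.Adj u v ∧ ∀ (hu : u ∈ s) (hv : v ∈ s), ¬ H.Adj ⟨u, hu⟩ ⟨v, hv⟩ with hdef
  have hG' (u v : V) : G'.Adj u v ↔
      G.Adj u v ∧ ∀ (hu : u ∈ s) (hv : v ∈ s), ¬ H.Adj ⟨u, hu⟩ ⟨v, hv⟩ := by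
    rw [hdef, SimpleGraph.fromRel_adj]
    constructor
    · rintro ⟨-, h | ⟨h, h'⟩⟩
      · exact h
      · exact ⟨h.symm, fun hu hv hH => h' hv hu hH.symm⟩
    · exact fun h => ⟨h.1.ne, Or.inl h⟩
  have key := dotProduct_adjMatrix_mulVec_eq_add G G' s H hsub hG'
  have h₁ : graphEnergy G ≤ graphEnergy G' + graphEnergy H := by
    obtain ⟨w, hw, h⟩ := exists_isBesselFamily_graphEnergy_eq G
    rw [h]
    refine le_trans ?_ (add_le_add (hw.sum_abs_le_graphEnergy G')
      ((hw.restrict (s := s)).sum_abs_le_graphEnergy H))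
    rw [← Finset.sum_add_distrib]
    refine Finset.sum_le_sum fun v _ => ?_
    rw [key]
    exact abs_add_le _ _
  have h₂ : graphEnergy G' ≤ graphEnergy G + graphEnergy H := by
    obtain ⟨w, hw, h⟩ := exists_isBesselFamily_graphEnergy_eq G'
    rw [h]
    refine le_trans ?_ (add_le_add (hw.sum_abs_le_graphEnergy G)
      ((hw.restrict (s := s)).sum_abs_le_graphEnergy H))
    rw [← Finset.sum_add_distrib]
    refine Finset.sum_le_sum fun v _ => ?_
    rw [eq_sub_of_add_eq (key (w v)).symm]
    exact abs_sub _ _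
  have h₃ : graphEnergy H ≤ graphEnergy G + graphEnergy G' := by
    obtain ⟨w, hw, h⟩ := exists_isBesselFamily_graphEnergy_eq H
    rw [h]
    refine le_trans ?_ (add_le_add (hw.extendZero.sum_abs_le_graphEnergy G)
      (hw.extendZero.sum_abs_le_graphEnergy G'))
    rw [← Finset.sum_add_distrib]
    refine Finset.sum_le_sum fun v _ => ?_
    have h := key (extendZero s (w v))
    simp only [extendZero_coe] at h
    rw [eq_sub_of_add_eq' h.symm]
    exact abs_sub _ _
  exact ⟨abs_le.2 ⟨by linarith, by linarith⟩, h₂⟩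
end

section
/- Let (G_n) and (H_n) be two sequences of finite simple graphs, with G_n and H_n on the same vertex set for each n, such that E(G_n) > 0 for all large n and Δ(G_n,H_n)/E(G_n) → 0 as n → ∞. Then E(H_n)/E(G_n) → 1 as n → ∞. -/
open Real Filter SimpleGraph

namespace Matrix

variable {n : Type*} [Fintype n] [DecidableEq n]

/-- Pairing a real symmetric matrix with an orthogonal matrix is bounded by the trace norm. -/
lemma IsHermitian.trace_mul_le_sum_abs_eigenvalues {A : Matrix n n ℝ} (hA : A.IsHermitian)
    (S : unitaryGroup n ℝ) :
    trace ((S : Matrix n n ℝ) * A) ≤ ∑ i, |hA.eigenvalues i| := by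
  set U := hA.eigenvectorUnitary
  have hspec : A = (U : Matrix n n ℝ) * diagonal hA.eigenvalues * star (U : Matrix n n ℝ) := by
    simpa [Unitary.conjStarAlgAut_apply, Function.comp_def] using hA.spectral_theorem
  have htr : trace ((S : Matrix n n ℝ) * A)
      = ∑ i, ((star U * S * U : unitaryGroup n ℝ) : Matrix n n ℝ) i i * hA.eigenvalues i := by
    conv_lhs => rw [hspec, ← Matrix.mul_assoc, trace_mul_comm]
    simp [trace, mul_diagonal, ← Matrix.mul_assoc]
  rw [htr]
  refine Finset.sum_le_sum fun i _ => (le_abs_self _).trans ?_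
  rw [abs_mul]
  exact mul_le_of_le_one_left (abs_nonneg _)
    (entry_norm_bound_of_unitary (star U * S * U).2 i i)

/-- The trace norm of a real symmetric matrix is attained by an orthogonal matrix. -/
lemma IsHermitian.exists_trace_mul_eq_sum_abs_eigenvalues {A : Matrix n n ℝ}
    (hA : A.IsHermitian) :
    ∃ S : unitaryGroup n ℝ, trace ((S : Matrix n n ℝ) * A) = ∑ i, |hA.eigenvalues i| := by
  set U := hA.eigenvectorUnitary
  have hspec : A = (U : Matrix n n ℝ) * diagonal hA.eigenvalues * star (U : Matrix n n ℝ) := by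
    simpa [Unitary.conjStarAlgAut_apply, Function.comp_def] using hA.spectral_theorem
  let s : n → ℝ := fun i => if 0 ≤ hA.eigenvalues i then 1 else -1
  have hs : diagonal s ∈ unitaryGroup n ℝ := by
    rw [mem_unitaryGroup_iff, star_eq_conjTranspose, diagonal_conjTranspose, diagonal_mul_diagonal,
      ← diagonal_one]
    congr 1
    ext i
    by_cases h : 0 ≤ hA.eigenvalues i <;> simp [s, h]
  have hU : star (U : Matrix n n ℝ) * U = 1 := UnitaryGroup.star_mul_self U
  refine ⟨U * ⟨diagonal s, hs⟩ * star U, ?_⟩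
  have hprod : ((U * ⟨diagonal s, hs⟩ * star U : unitaryGroup n ℝ) : Matrix n n ℝ) * A
      = (U : Matrix n n ℝ) * (diagonal s * diagonal hA.eigenvalues) * star (U : Matrix n n ℝ) := by
    conv_lhs => rw [hspec]
    calc (U : Matrix n n ℝ) * diagonal s * star (U : Matrix n n ℝ) *
          ((U : Matrix n n ℝ) * diagonal hA.eigenvalues * star (U : Matrix n n ℝ))
        = (U : Matrix n n ℝ) * diagonal s * (star (U : Matrix n n ℝ) * U) *
            diagonal hA.eigenvalues * star (U : Matrix n n ℝ) := by simp only [Matrix.mul_assoc]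
      _ = _ := by rw [hU]; simp only [Matrix.mul_assoc, Matrix.one_mul]
  rw [hprod, trace_mul_comm, ← Matrix.mul_assoc, hU, Matrix.one_mul, diagonal_mul_diagonal,
    trace_diagonal]
  refine Finset.sum_congr rfl fun i _ => ?_
  by_cases h : 0 ≤ hA.eigenvalues i
  · simp [s, h, abs_of_nonneg]
  · simp [s, h, abs_of_neg (not_le.mp h)]

/-- Perturbing a real symmetric matrix changes its trace norm by at most the entrywise
`ℓ¹` norm of the perturbation. -/
lemma IsHermitian.sum_abs_eigenvalues_le_add {A B : Matrix n n ℝ} (hA : A.IsHermitian)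
    (hB : B.IsHermitian) :
    ∑ i, |hB.eigenvalues i| ≤ ∑ i, |hA.eigenvalues i| + ∑ i, ∑ j, |B i j - A i j| := by
  obtain ⟨S, hS⟩ := hB.exists_trace_mul_eq_sum_abs_eigenvalues
  have hD : trace ((S : Matrix n n ℝ) * (B - A)) ≤ ∑ i, ∑ j, |B i j - A i j| := by
    rw [trace_mul_comm]
    refine Finset.sum_le_sum fun i _ => ?_
    rw [diag_apply, mul_apply]
    refine Finset.sum_le_sum fun j _ => (le_abs_self _).trans ?_
    rw [abs_mul, sub_apply]
    exact mul_le_of_le_one_right (abs_nonneg _) (entry_norm_bound_of_unitary S.2 j i)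
  have hA' := hA.trace_mul_le_sum_abs_eigenvalues S
  rw [Matrix.mul_sub, trace_sub] at hD
  linarith

end Matrix

namespace SimpleGraph

variable {V : Type*} [Fintype V]

lemma sum_sum_adjMatrix (G : SimpleGraph V) [DecidableRel G.Adj] :
    ∑ i, ∑ j, G.adjMatrix ℝ i j = 2 * (G.edgeFinset.card : ℝ) := by
  have h := G.sum_degrees_eq_twice_card_edges
  have hdeg (i : V) : ∑ j, G.adjMatrix ℝ i j = (G.degree i : ℝ) := by
    simp [adjMatrix_apply, Finset.sum_boole, ← card_neighborFinset_eq_degree,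
      neighborFinset_eq_filter]
  simp only [hdeg]
  exact_mod_cast h

variable [DecidableEq V]

lemma sum_sum_abs_adjMatrix_sub (G H : SimpleGraph V) [DecidableRel G.Adj]
    [DecidableRel H.Adj] :
    ∑ i, ∑ j, |H.adjMatrix ℝ i j - G.adjMatrix ℝ i j|
      = 2 * ((G.edgeFinset.card : ℝ) + (H.edgeFinset.card : ℝ)
          - 2 * ((G.edgeFinset ∩ H.edgeFinset).card : ℝ)) := by
  have hentry (i j : V) : |H.adjMatrix ℝ i j - G.adjMatrix ℝ i j|
      = G.adjMatrix ℝ i j + H.adjMatrix ℝ i j - 2 * (G ⊓ H).adjMatrix ℝ i j := by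
    by_cases hG : G.Adj i j <;> by_cases hH : H.Adj i j <;>
      norm_num [adjMatrix_apply, hG, hH]
  simp only [hentry, Finset.sum_sub_distrib, Finset.sum_add_distrib, ← Finset.mul_sum,
    sum_sum_adjMatrix, edgeFinset_inf]
  ring

lemma graphEnergy_le_add (G H : SimpleGraph V) [DecidableRel G.Adj] [DecidableRel H.Adj] :
    graphEnergy H ≤ graphEnergy G + 2 * ((G.edgeFinset.card : ℝ) + (H.edgeFinset.card : ℝ)
      - 2 * ((G.edgeFinset ∩ H.edgeFinset).card : ℝ)) := by
  have henergy (K : SimpleGraph V) [DecidableRel K.Adj] :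
      graphEnergy K = ∑ v, |(adjMatrix_isHermitian K).eigenvalues v| := by
    unfold graphEnergy graphEigenvalues
    congr!
  rw [henergy, henergy, ← sum_sum_abs_adjMatrix_sub]
  exact (adjMatrix_isHermitian G).sum_abs_eigenvalues_le_add (adjMatrix_isHermitian H)

/-- The energy is `2`-Lipschitz for the edit distance. -/
lemma abs_graphEnergy_sub_le (G H : SimpleGraph V) [DecidableRel G.Adj] [DecidableRel H.Adj] :
    |graphEnergy H - graphEnergy G| ≤ 2 * ((G.edgeFinset.card : ℝ) + (H.edgeFinset.card : ℝ)
      - 2 * ((G.edgeFinset ∩ H.edgeFinset).card : ℝ)) := by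
  have h₁ := graphEnergy_le_add G H
  have h₂ := graphEnergy_le_add H G
  rw [Finset.inter_comm] at h₂
  rw [abs_le]
  constructor <;> linarith

end SimpleGraph

/-- if `(G_n)`, `(H_n)` are sequences of graphs on the same vertex sets
with `E(G_n) > 0` for all large `n` and `Δ(G_n,H_n)/E(G_n) → 0`, then
`E(H_n)/E(G_n) → 1`. Here `Δ(G,H) = |E(G)| + |E(H)| − 2|E(G) ∩ E(H)|`. -/
theorem energy_ratio_tendsto_one {V : ℕ → Type*} [∀ n, Fintype (V n)]
    [∀ n, DecidableEq (V n)] (G H : ∀ n, SimpleGraph (V n))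
    [∀ n, DecidableRel (G n).Adj] [∀ n, DecidableRel (H n).Adj]
    (hpos : ∀ᶠ n in atTop, 0 < graphEnergy (G n))
    (hΔ : Tendsto (fun n =>
        (((G n).edgeFinset.card : ℝ) + ((H n).edgeFinset.card : ℝ) -
          2 * (((G n).edgeFinset ∩ (H n).edgeFinset).card : ℝ)) / graphEnergy (G n))
      atTop (nhds 0)) :
    Tendsto (fun n => graphEnergy (H n) / graphEnergy (G n)) atTop (nhds 1) := by
  rw [tendsto_iff_norm_sub_tendsto_zero]
  refine squeeze_zero' (Eventually.of_forall fun n => norm_nonneg _) ?_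
    (by simpa using hΔ.const_mul 2)
  filter_upwards [hpos] with n hn
  rw [Real.norm_eq_abs, div_sub_one hn.ne', abs_div, abs_of_pos hn, ← mul_div_assoc]
  gcongr
  exact abs_graphEnergy_sub_le (G n) (H n)
end

section
/- Let n, m ≥ 3 and let T^t(n,m) be the toroidal triangular lattice. Then E(T^t(n,m)) = Σ_{i=0}^{n−1} Σ_{j=0}^{m−1} |2cos(2πi/n) + 2cos(2πj/m) + 2cos(2πi/n + 2πj/m)|. -/
open Real Filter SimpleGraph

/-- The toroidal triangular lattice `T^t(n,m)`: the simple graph on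
`(ℤ/nℤ) × (ℤ/mℤ)` in which `(i,j)` is adjacent to `(i±1,j)`, `(i,j±1)`,
`(i+1,j+1)` and `(i−1,j−1)`. -/
def triTorus (n m : ℕ) : SimpleGraph (ZMod n × ZMod m) :=
  SimpleGraph.fromRel fun u v =>
    (v.1 = u.1 + 1 ∧ v.2 = u.2) ∨ (v.1 = u.1 ∧ v.2 = u.2 + 1) ∨
      (v.1 = u.1 + 1 ∧ v.2 = u.2 + 1)

/-- A real square matrix which is diagonalised over `ℂ` with real eigenvalues `d` has characteristic
polynomial `∏ v, (X - d v)`. -/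
lemma charpoly_eq_prod_of_map_mul_eq {V : Type*} [Fintype V] [DecidableEq V]
    (A : Matrix V V ℝ) (P : Matrix V V ℂ) (hP : IsUnit P) (d : V → ℝ)
    (h : A.map Complex.ofRealHom * P = P * Matrix.diagonal fun v => (d v : ℂ)) :
    A.charpoly = ∏ v, (Polynomial.X - Polynomial.C (d v)) := by
  obtain ⟨U, rfl⟩ := hP
  apply Polynomial.map_injective Complex.ofRealHom Complex.ofRealHom.injective
  rw [← Matrix.charpoly_map]
  have hA : A.map Complex.ofRealHom =
      U.val * (Matrix.diagonal fun v => (d v : ℂ)) * U⁻¹.val := by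
    rw [← h, mul_assoc, Units.mul_inv, mul_one]
  rw [hA, Matrix.charpoly_mul_comm, ← mul_assoc, Units.inv_mul, one_mul,
    Matrix.charpoly_diagonal, Polynomial.map_prod]
  simp

/-- The energy of a graph is determined by any splitting of its characteristic polynomial. -/
lemma graphEnergy_eq_sum_abs {V : Type*} [Fintype V] [DecidableEq V]
    (G : SimpleGraph V) [DecidableRel G.Adj] (d : V → ℝ)
    (h : (G.adjMatrix ℝ).charpoly = ∏ v, (Polynomial.X - Polynomial.C (d v))) :
    graphEnergy G = ∑ v, |d v| := by
  have key : Finset.univ.val.map (adjMatrix_isHermitian G).eigenvalues =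
      Finset.univ.val.map d := by
    have h₁ := (adjMatrix_isHermitian G).roots_charpoly_eq_eigenvalues
    rw [h, Polynomial.roots_prod _ _
      (Finset.prod_ne_zero_iff.mpr fun v _ => Polynomial.X_sub_C_ne_zero (d v))] at h₁
    simpa [Function.comp_def] using h₁.symm
  have hs := congrArg (fun s => (s.map fun x : ℝ => |x|).sum) key
  simp only [Multiset.map_map, Function.comp_def, Finset.sum_map_val] at hs
  unfold graphEnergy graphEigenvalues
  convert! hs

/-- The eigenvalue of `triTorus n m` at the character with index `(i, j)`. -/
noncomputable def triTorusEigenvalue (n m i j : ℕ) : ℝ :=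
  2 * Real.cos (2 * π * (i : ℝ) / (n : ℝ)) + 2 * Real.cos (2 * π * (j : ℝ) / (m : ℝ)) +
    2 * Real.cos (2 * π * (i : ℝ) / (n : ℝ) + 2 * π * (j : ℝ) / (m : ℝ))

/-- The character table of `(ℤ/nℤ) × (ℤ/mℤ)`. -/
noncomputable def torusCharTable (n m : ℕ) [NeZero n] [NeZero m] :
    Matrix (ZMod n × ZMod m) (ZMod n × ZMod m) ℂ :=
  Matrix.of fun u k => ZMod.stdAddChar (u.1 * k.1) * ZMod.stdAddChar (u.2 * k.2)

lemma isUnit_torusCharTable (n m : ℕ) [NeZero n] [NeZero m] :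
    IsUnit (torusCharTable n m) := by
  have hmul : torusCharTable n m * (Matrix.of fun k v => torusCharTable n m (-v) k) =
      ((n : ℂ) * m) • 1 := by
    ext u v
    have hterm : ∀ k : ZMod n × ZMod m, torusCharTable n m u k * torusCharTable n m (-v) k =
        ZMod.stdAddChar (k.1 * (u.1 - v.1)) * ZMod.stdAddChar (k.2 * (u.2 - v.2)) := by
      intro k
      simp only [torusCharTable, Matrix.of_apply, Prod.fst_neg, Prod.snd_neg]
      rw [mul_mul_mul_comm, ← AddChar.map_add_eq_mul, ← AddChar.map_add_eq_mul]
      congr 2 <;> ring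
    simp only [Matrix.mul_apply, Matrix.of_apply, hterm]
    rw [Fintype.sum_prod_type]
    simp only
    rw [← Fintype.sum_mul_sum, AddChar.sum_mulShift _ (ZMod.isPrimitive_stdAddChar n),
      AddChar.sum_mulShift _ (ZMod.isPrimitive_stdAddChar m)]
    simp only [sub_eq_zero, ZMod.card, Matrix.smul_apply, Matrix.one_apply, Prod.ext_iff]
    split_ifs <;> simp_all
  have hc : (n : ℂ) * m ≠ 0 := mul_ne_zero (NeZero.ne _) (NeZero.ne _)
  refine IsUnit.of_mul_eq_one (((n : ℂ) * m)⁻¹ • Matrix.of fun k v => torusCharTable n m (-v) k) ?_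
  rw [mul_smul_comm, hmul, smul_smul, inv_mul_cancel₀ hc, one_smul]

lemma stdAddChar_add_stdAddChar_neg {n : ℕ} [NeZero n] (k : ZMod n) :
    ZMod.stdAddChar k + ZMod.stdAddChar (-k) =
      ((2 * Real.cos (2 * π * (k.val : ℝ) / (n : ℝ)) : ℝ) : ℂ) := by
  have hk : k = ((k.val : ℤ) : ZMod n) := by simp
  conv_lhs => rw [hk]
  rw [← Int.cast_neg, ZMod.stdAddChar_coe, ZMod.stdAddChar_coe]
  push_cast
  rw [Complex.two_cos]
  congr 2 <;> ring

lemma stdAddChar_mul_add_stdAddChar_neg_mul {n m : ℕ} [NeZero n] [NeZero m]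
    (k : ZMod n) (l : ZMod m) :
    ZMod.stdAddChar k * ZMod.stdAddChar l + ZMod.stdAddChar (-k) * ZMod.stdAddChar (-l) =
      ((2 * Real.cos (2 * π * (k.val : ℝ) / (n : ℝ) + 2 * π * (l.val : ℝ) / (m : ℝ)) : ℝ) :
        ℂ) := by
  have hk : k = ((k.val : ℤ) : ZMod n) := by simp
  have hl : l = ((l.val : ℤ) : ZMod m) := by simp
  conv_lhs => rw [hk, hl]
  rw [← Int.cast_neg, ← Int.cast_neg]
  simp only [ZMod.stdAddChar_coe, ← Complex.exp_add]
  push_cast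
  rw [Complex.two_cos]
  congr 2 <;> ring

lemma sum_zmod_eq_sum_range {M : Type*} [AddCommMonoid M] (n : ℕ) [NeZero n] (f : ℕ → M) :
    ∑ k : ZMod n, f k.val = ∑ i ∈ Finset.range n, f i := by
  refine Finset.sum_bij' (fun k _ => k.val) (fun i _ => (i : ZMod n)) ?_ ?_ ?_ ?_ ?_
  · intro k _; simpa using k.val_lt
  · simp
  · simp
  · intro i hi; exact ZMod.val_cast_of_lt (Finset.mem_range.mp hi)
  · simp

lemma ZMod.one_ne_neg_one_of_three_le {n : ℕ} (hn : 3 ≤ n) : (1 : ZMod n) ≠ -1 := by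
  have : Fact (2 < n) := ⟨hn⟩
  exact (ZMod.neg_one_ne_one (n := n)).symm

lemma triTorus_adj {n m : ℕ} (hn : 3 ≤ n) (hm : 3 ≤ m) (u v : ZMod n × ZMod m) :
    (triTorus n m).Adj u v ↔ v = u + (1, 0) ∨ v = u - (1, 0) ∨ v = u + (0, 1) ∨
      v = u - (0, 1) ∨ v = u + (1, 1) ∨ v = u - (1, 1) := by
  have : Fact (1 < n) := ⟨by omega⟩
  have : Fact (1 < m) := ⟨by omega⟩
  have h₁ : (1 : ZMod n) ≠ 0 := one_ne_zero
  have h₂ : (1 : ZMod m) ≠ 0 := one_ne_zero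
  obtain ⟨a, b⟩ := u
  obtain ⟨c, d⟩ := v
  simp only [triTorus, SimpleGraph.fromRel_adj, Prod.mk.injEq, Prod.mk_add_mk, Prod.mk_sub_mk,
    ne_eq, add_zero, sub_zero]
  grind

lemma adjMatrix_triTorus_apply {n m : ℕ} (hn : 3 ≤ n) (hm : 3 ≤ m)
    [DecidableRel (triTorus n m).Adj] (u v : ZMod n × ZMod m) :
    (triTorus n m).adjMatrix ℝ u v =
      (if v = u + (1, 0) then 1 else 0) + (if v = u - (1, 0) then 1 else 0) +
      (if v = u + (0, 1) then 1 else 0) + (if v = u - (0, 1) then 1 else 0) +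
      (if v = u + (1, 1) then 1 else 0) + (if v = u - (1, 1) then 1 else 0) := by
  have : Fact (1 < n) := ⟨by omega⟩
  have : Fact (1 < m) := ⟨by omega⟩
  rw [SimpleGraph.adjMatrix_apply]
  simp only [triTorus_adj hn hm]
  obtain ⟨a, b⟩ := u
  obtain ⟨c, d⟩ := v
  simp only [Prod.mk.injEq, Prod.mk_add_mk, Prod.mk_sub_mk, add_zero, sub_zero]
  have ha₁ : a + 1 ≠ a := by simp
  have ha₂ : a - 1 ≠ a := by simp
  have ha₃ : a + 1 ≠ a - 1 := by
    simpa [sub_eq_add_neg] using ZMod.one_ne_neg_one_of_three_le hn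
  have hb₁ : b + 1 ≠ b := by simp
  have hb₂ : b - 1 ≠ b := by simp
  have hb₃ : b + 1 ≠ b - 1 := by
    simpa [sub_eq_add_neg] using ZMod.one_ne_neg_one_of_three_le hm
  generalize a + 1 = a₁ at *
  generalize a - 1 = a₂ at *
  generalize b + 1 = b₁ at *
  generalize b - 1 = b₂ at *
  clear hn hm
  split_ifs <;> grind

lemma adjMatrix_triTorus_mul_torusCharTable {n m : ℕ} [NeZero n] [NeZero m]
    (hn : 3 ≤ n) (hm : 3 ≤ m) [DecidableRel (triTorus n m).Adj] :
    ((triTorus n m).adjMatrix ℝ).map Complex.ofRealHom * torusCharTable n m =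
      torusCharTable n m * Matrix.diagonal fun k =>
        ((triTorusEigenvalue n m k.1.val k.2.val : ℝ) : ℂ) := by
  ext u k
  have hadd : ∀ w, torusCharTable n m (u + w) k =
      torusCharTable n m u k * torusCharTable n m w k := by
    intro w
    simp only [torusCharTable, Matrix.of_apply, Prod.fst_add, Prod.snd_add, add_mul,
      AddChar.map_add_eq_mul]
    ring
  have hsub : ∀ w, torusCharTable n m (u - w) k =
      torusCharTable n m u k * torusCharTable n m (-w) k := fun w => by
    rw [sub_eq_add_neg, hadd]
  have hE : (triTorusEigenvalue n m k.1.val k.2.val : ℂ) =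
      (ZMod.stdAddChar k.1 + ZMod.stdAddChar (-k.1)) +
      (ZMod.stdAddChar k.2 + ZMod.stdAddChar (-k.2)) +
      (ZMod.stdAddChar k.1 * ZMod.stdAddChar k.2 +
        ZMod.stdAddChar (-k.1) * ZMod.stdAddChar (-k.2)) := by
    rw [stdAddChar_add_stdAddChar_neg, stdAddChar_add_stdAddChar_neg,
      stdAddChar_mul_add_stdAddChar_neg_mul, ← Complex.ofReal_add, ← Complex.ofReal_add,
      triTorusEigenvalue]
  rw [Matrix.mul_diagonal]
  simp only [Matrix.mul_apply, Matrix.map_apply, adjMatrix_triTorus_apply hn hm,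
    map_add, apply_ite Complex.ofRealHom, map_one, map_zero, add_mul, ite_mul,
    one_mul, zero_mul, Finset.sum_add_distrib, Finset.sum_ite_eq', Finset.mem_univ, if_true,
    hadd, hsub]
  simp only [hE, torusCharTable, Matrix.of_apply, Prod.fst_neg, Prod.snd_neg, neg_mul,
    one_mul, zero_mul, neg_zero, AddChar.map_zero_eq_one, mul_one]
  ring

/-- the energy of the toroidal triangular lattice `T^t(n,m)`
(`n, m ≥ 3`) equals
`Σ_{i=0}^{n−1} Σ_{j=0}^{m−1} |2cos(2πi/n) + 2cos(2πj/m) + 2cos(2πi/n + 2πj/m)|`. -/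
theorem energy_triTorus (n m : ℕ) [NeZero n] [NeZero m] (hn : 3 ≤ n) (hm : 3 ≤ m) :
    graphEnergy (triTorus n m) =
      ∑ i ∈ Finset.range n, ∑ j ∈ Finset.range m,
        |2 * Real.cos (2 * π * (i : ℝ) / (n : ℝ)) +
          2 * Real.cos (2 * π * (j : ℝ) / (m : ℝ)) +
          2 * Real.cos (2 * π * (i : ℝ) / (n : ℝ) + 2 * π * (j : ℝ) / (m : ℝ))| := by
  classical
  rw [graphEnergy_eq_sum_abs _ _ (charpoly_eq_prod_of_map_mul_eq _ _ (isUnit_torusCharTable n m) _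
    (adjMatrix_triTorus_mul_torusCharTable hn hm)), Fintype.sum_prod_type,
    sum_zmod_eq_sum_range n fun i => ∑ l : ZMod m, |triTorusEigenvalue n m i l.val|]
  refine Finset.sum_congr rfl fun i _ => ?_
  rw [sum_zmod_eq_sum_range m fun j => |triTorusEigenvalue n m i j|]
  rfl
end

section
/- For the free-boundary triangular lattice T^f(n,m), the energy per vertex converges as n, m → ∞ (jointly, i.e., along the product filter): lim_{n,m→∞} E(T^f(n,m))/(nm) = (1/(2π²)) ∫₀^{2π} ∫₀^{2π} |cos x + cos y + cos(x+y)| dx dy. In particular the triangular lattices with free and toroidal boundary conditions have the same asymptotic energy per vertex. -/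
open Real Filter SimpleGraph

/-- The free-boundary triangular lattice `T^f(n,m)`: the simple graph on
`{0,…,n−1} × {0,…,m−1}` in which `(i,j)` is adjacent to `(i+1,j)`, `(i,j+1)`
and `(i+1,j+1)` (whenever these lie in range). -/
def triFree (n m : ℕ) : SimpleGraph (Fin n × Fin m) :=
  SimpleGraph.fromRel fun u v =>
    ((v.1 : ℕ) = (u.1 : ℕ) + 1 ∧ v.2 = u.2) ∨
      (v.1 = u.1 ∧ (v.2 : ℕ) = (u.2 : ℕ) + 1) ∨
      ((v.1 : ℕ) = (u.1 : ℕ) + 1 ∧ (v.2 : ℕ) = (u.2 : ℕ) + 1)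

/-! ### Iterated integrals over the square of periods -/

lemma iterated_integral_sum {ι : Type*} (s : Finset ι) (c : ι → ℝ) (g : ι → ℝ → ℝ → ℝ)
    (hg : ∀ i ∈ s, Continuous (Function.uncurry (g i))) (a b : ℝ) :
    ∫ x in a..b, ∫ y in a..b, ∑ i ∈ s, c i * g i x y
      = ∑ i ∈ s, c i * ∫ x in a..b, ∫ y in a..b, g i x y := by
  have inner : ∀ x, ∫ y in a..b, ∑ i ∈ s, c i * g i x y
      = ∑ i ∈ s, c i * ∫ y in a..b, g i x y := by
    intro x
    rw [intervalIntegral.integral_finsetSum]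
    · simp_rw [intervalIntegral.integral_const_mul]
    · intro i hi
      have : Continuous fun y => g i x y := (hg i hi).comp (by fun_prop : Continuous fun y => (x, y))
      exact (continuous_const.mul this).intervalIntegrable _ _
  simp_rw [inner]
  rw [intervalIntegral.integral_finsetSum]
  · simp_rw [intervalIntegral.integral_const_mul]
  · intro i hi
    exact (continuous_const.mul
      (intervalIntegral.continuous_parametric_intervalIntegral_of_continuous' (hg i hi) a b)).intervalIntegrable _ _

lemma integral_cos_add_int_mul (c : ℝ) (b : ℤ) :
    ∫ y in (0:ℝ)..2 * π, cos (c + b * y) = if b = 0 then 2 * π * cos c else 0 := by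
  split_ifs with hb
  · simp [hb]
  · have hb' : (b : ℝ) ≠ 0 := by exact_mod_cast hb
    rw [intervalIntegral.integral_comp_add_mul (fun t => cos t) hb', integral_cos,
      Real.sin_add_int_mul_two_pi]
    simp

lemma iterated_integral_cos_int (a b : ℤ) :
    ∫ x in (0:ℝ)..2 * π, ∫ y in (0:ℝ)..2 * π, cos (a * x + b * y)
      = if a = 0 ∧ b = 0 then 4 * π ^ 2 else 0 := by
  simp_rw [integral_cos_add_int_mul]
  by_cases hb : b = 0
  · have h := integral_cos_add_int_mul 0 a
    simp only [zero_add, cos_zero, mul_one] at h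
    simp only [hb, if_true, and_true, intervalIntegral.integral_const_mul, h]
    split_ifs <;> ring
  · simp [hb]

/-! ### Spectral estimates -/

section Spectral

variable {V : Type*} [Fintype V] [DecidableEq V] {A : Matrix V V ℝ} (hA : A.IsHermitian)

lemma sum_sq_eigenvectorBasis_dotProduct (w : V → ℝ) :
    ∑ k, dotProduct (hA.eigenvectorBasis k) w ^ 2 = ∑ u, w u ^ 2 := by
  have h := hA.eigenvectorBasis.sum_sq_norm_inner_right (WithLp.toLp 2 w)
  simp only [EuclideanSpace.norm_sq_eq, Real.norm_eq_abs, sq_abs] at h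
  rw [← h]
  refine Finset.sum_congr rfl fun k _ => ?_
  simp [EuclideanSpace.inner_eq_star_dotProduct, dotProduct_comm]

lemma eigenvectorBasis_dotProduct_mulVec_sub (w : V → ℝ) (f : ℝ) (k : V) :
    dotProduct (hA.eigenvectorBasis k) (A.mulVec w - f • w)
      = (hA.eigenvalues k - f) * dotProduct (hA.eigenvectorBasis k) w := by
  have hT : A.transpose = A := by simpa using hA.eq
  rw [dotProduct_sub, dotProduct_smul, Matrix.dotProduct_mulVec, ← Matrix.mulVec_transpose, hT,
    hA.mulVec_eigenvectorBasis, smul_dotProduct, smul_eq_mul, smul_eq_mul]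
  ring

lemma sum_eigenvalue_sub_sq_mul (w : V → ℝ) (f : ℝ) :
    ∑ k, dotProduct (hA.eigenvectorBasis k) w ^ 2 * (hA.eigenvalues k - f) ^ 2
      = ∑ u, (A.mulVec w u - f * w u) ^ 2 := by
  have h := sum_sq_eigenvectorBasis_dotProduct hA (A.mulVec w - f • w)
  simp only [eigenvectorBasis_dotProduct_mulVec_sub, Pi.sub_apply, Pi.smul_apply, smul_eq_mul] at h
  rw [← h]
  exact Finset.sum_congr rfl fun k _ => by ring

end Spectral

lemma abs_sum_mul_abs_sub_le {ι : Type*} [Fintype ι] (P l : ι → ℝ) (hP : ∀ k, 0 ≤ P k) (f : ℝ) :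
    |∑ k, P k * |l k| - (∑ k, P k) * (|f|)|
      ≤ √((∑ k, P k) * ∑ k, P k * (l k - f) ^ 2) := by
  apply Real.le_sqrt_of_sq_le
  have h1 : |∑ k, P k * |l k| - (∑ k, P k) * (|f|)| ≤ ∑ k, P k * |l k - f| := by
    rw [Finset.sum_mul, ← Finset.sum_sub_distrib]
    refine (Finset.abs_sum_le_sum_abs _ _).trans (Finset.sum_le_sum fun k _ => ?_)
    rw [← mul_sub, abs_mul, abs_of_nonneg (hP k)]
    exact mul_le_mul_of_nonneg_left (abs_abs_sub_abs_le _ _) (hP k)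
  refine (pow_le_pow_left₀ (abs_nonneg _) h1 2).trans ?_
  refine Finset.sum_sq_le_sum_mul_sum_of_sq_le_mul _ (fun k _ => hP k)
    (fun k _ => mul_nonneg (hP k) (sq_nonneg _)) fun k _ => le_of_eq ?_
  rw [mul_pow, sq_abs]
  ring

/-! ### The triangular lattice -/

/-- The six steps from a vertex of the triangular lattice to its neighbours. -/
def triSteps : Finset (ℤ × ℤ) := {(1, 0), (-1, 0), (0, 1), (0, -1), (1, 1), (-1, -1)}

/-- The position in `ℤ × ℤ` of a vertex of the finite lattice. -/
def triPos {n m : ℕ} (u : Fin n × Fin m) : ℤ × ℤ := ((u.1 : ℕ), (u.2 : ℕ))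

lemma triPos_injective {n m : ℕ} : Function.Injective (triPos : Fin n × Fin m → ℤ × ℤ) := by
  rintro ⟨a, b⟩ ⟨c, d⟩ h
  simp only [triPos, Prod.mk.injEq, Nat.cast_inj] at h
  exact Prod.ext (Fin.ext h.1) (Fin.ext h.2)

lemma triFree_adj_iff {n m : ℕ} (u v : Fin n × Fin m) :
    (triFree n m).Adj u v ↔ triPos v - triPos u ∈ triSteps := by
  obtain ⟨⟨a, ha⟩, ⟨b, hb⟩⟩ := u
  obtain ⟨⟨c, hc⟩, ⟨d, hd⟩⟩ := v
  simp only [triFree, SimpleGraph.fromRel_adj, triPos, triSteps, Finset.mem_insert,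
    Finset.mem_singleton, Prod.mk_sub_mk, Prod.mk.injEq, Fin.mk.injEq, ne_eq]
  omega

lemma adjMatrix_triFree_mulVec {n m : ℕ} [DecidableRel (triFree n m).Adj] (g : ℤ × ℤ → ℝ)
    (u : Fin n × Fin m) :
    ((triFree n m).adjMatrix ℝ).mulVec (fun v => g (triPos v)) u
      = ∑ d ∈ triSteps, if triPos u + d ∈ Set.range (triPos : Fin n × Fin m → ℤ × ℤ)
          then g (triPos u + d) else 0 := by
  classical
  have key : ∀ d : ℤ × ℤ, (if triPos u + d ∈ Set.range (triPos : Fin n × Fin m → ℤ × ℤ)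
      then g (triPos u + d) else 0)
      = ∑ v : Fin n × Fin m, if triPos v - triPos u = d then g (triPos v) else 0 := by
    intro d
    split_ifs with h
    · obtain ⟨w, hw⟩ := h
      rw [Finset.sum_eq_single w]
      · rw [if_pos (by rw [hw]; abel), hw]
      · intro v _ hv
        rw [if_neg]
        rintro rfl
        exact hv (triPos_injective (by rw [hw]; abel))
      · simp
    · refine (Finset.sum_eq_zero fun v _ => if_neg ?_).symm
      rintro rfl
      exact h ⟨v, by abel⟩
  simp_rw [key]
  rw [Finset.sum_comm]
  simp only [Matrix.mulVec, dotProduct, SimpleGraph.adjMatrix_apply, triFree_adj_iff,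
    Finset.sum_ite_eq, ite_mul, one_mul, zero_mul]

/-- The indicator of the endpoints of `Fin n`, counted twice when they coincide. -/
def endIndicator {n : ℕ} (i : Fin n) : ℝ :=
  (if (i : ℕ) = 0 then 1 else 0) + (if (i : ℕ) + 1 = n then 1 else 0)

/-- The indicator of the boundary of the finite lattice, with corners counted repeatedly. -/
def triBoundary {n m : ℕ} (u : Fin n × Fin m) : ℝ := endIndicator u.1 + endIndicator u.2

lemma sum_ite_le_one {n : ℕ} (p : Fin n → Prop) [DecidablePred p]
    (hp : ∀ i j, p i → p j → i = j) : ∑ i, (if p i then (1 : ℝ) else 0) ≤ 1 := by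
  rw [Finset.sum_boole]
  exact_mod_cast Finset.card_le_one.2 fun i hi j hj =>
    hp i j (Finset.mem_filter.1 hi).2 (Finset.mem_filter.1 hj).2

lemma sum_endIndicator_le (n : ℕ) : ∑ i : Fin n, endIndicator i ≤ 2 := by
  have h1 := sum_ite_le_one (fun i : Fin n => (i : ℕ) = 0) fun i j hi hj => Fin.ext (by omega)
  have h2 := sum_ite_le_one (fun i : Fin n => (i : ℕ) + 1 = n) fun i j hi hj => Fin.ext (by omega)
  simp only [endIndicator, Finset.sum_add_distrib]
  linarith

lemma sum_triBoundary_le (n m : ℕ) :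
    ∑ u : Fin n × Fin m, triBoundary u ≤ 2 * (n + m) := by
  simp only [triBoundary, Fintype.sum_prod_type, Finset.sum_add_distrib, Finset.sum_const,
    Finset.card_univ, Fintype.card_fin, nsmul_eq_mul, ← Finset.mul_sum]
  linarith [mul_le_mul_of_nonneg_left (sum_endIndicator_le n) (Nat.cast_nonneg (α := ℝ) m),
    mul_le_mul_of_nonneg_left (sum_endIndicator_le m) (Nat.cast_nonneg (α := ℝ) n)]

lemma triPos_add_mem_range_or {n m : ℕ} (u : Fin n × Fin m) :
    (∀ d ∈ triSteps, triPos u + d ∈ Set.range (triPos : Fin n × Fin m → ℤ × ℤ))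
      ∨ 1 ≤ triBoundary u := by
  obtain ⟨⟨a, ha⟩, ⟨b, hb⟩⟩ := u
  by_cases h : a = 0 ∨ a + 1 = n ∨ b = 0 ∨ b + 1 = m
  · right
    simp only [triBoundary, endIndicator]
    have nn : ∀ (p : Prop) [Decidable p], (0 : ℝ) ≤ if p then 1 else 0 := fun p _ => by
      split_ifs <;> norm_num
    rcases h with h | h | h | h <;> rw [if_pos h] <;>
      linarith [nn (a = 0), nn (a + 1 = n), nn (b = 0), nn (b + 1 = m)]
  · left
    rintro ⟨d, e⟩ hd
    have hd' : -1 ≤ d ∧ d ≤ 1 ∧ -1 ≤ e ∧ e ≤ 1 := by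
      simp only [triSteps, Finset.mem_insert, Finset.mem_singleton, Prod.mk.injEq] at hd
      omega
    refine ⟨(⟨(a + d).toNat, by omega⟩, ⟨(b + e).toNat, by omega⟩), ?_⟩
    simp only [triPos, Prod.mk_add_mk, Prod.mk.injEq]
    omega

lemma sum_sq_adjMatrix_triFree_sub_le {n m : ℕ} [DecidableRel (triFree n m).Adj]
    (g : ℤ × ℤ → ℝ) (hg : ∀ z, |g z| ≤ 1) (f : ℝ)
    (hf : ∀ z, ∑ d ∈ triSteps, g (z + d) = f * g z) :
    ∑ u : Fin n × Fin m, (((triFree n m).adjMatrix ℝ).mulVec (fun v => g (triPos v)) u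
      - f * g (triPos u)) ^ 2 ≤ 72 * (n + m) := by
  classical
  have pt : ∀ u : Fin n × Fin m, (((triFree n m).adjMatrix ℝ).mulVec (fun v => g (triPos v)) u
      - f * g (triPos u)) ^ 2 ≤ 36 * triBoundary u := by
    intro u
    rw [adjMatrix_triFree_mulVec, ← hf, ← Finset.sum_sub_distrib]
    rcases triPos_add_mem_range_or u with h | h
    · rw [Finset.sum_eq_zero fun d hd => by rw [if_pos (h d hd), sub_self]]
      have : 0 ≤ triBoundary u := by
        unfold triBoundary endIndicator
        positivity
      nlinarith
    · have hs : |∑ d ∈ triSteps, ((if triPos u + d ∈ Set.range (triPos : Fin n × Fin m → ℤ × ℤ)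
          then g (triPos u + d) else 0) - g (triPos u + d))| ≤ 6 := by
        refine (Finset.abs_sum_le_sum_abs _ _).trans
          ((Finset.sum_le_card_nsmul triSteps _ 1 fun d _ => ?_).trans ?_)
        · split_ifs
          · simp
          · simpa using hg _
        · have : triSteps.card = 6 := by decide
          simp [this]
      nlinarith [sq_le_sq' (abs_le.1 hs).1 (abs_le.1 hs).2]
  refine (Finset.sum_le_sum fun u _ => pt u).trans ?_
  rw [← Finset.mul_sum]
  linarith [sum_triBoundary_le n m]

/-- The phase at `z` of the plane wave with wave vector `(x, y)`. -/
noncomputable def planePhase (x y : ℝ) (z : ℤ × ℤ) : ℝ := z.1 * x + z.2 * y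

lemma sum_triSteps {M : Type*} [AddCommMonoid M] (g : ℤ × ℤ → M) :
    ∑ d ∈ triSteps, g d = g (1, 0) + (g (-1, 0) + (g (0, 1) + (g (0, -1)
      + (g (1, 1) + g (-1, -1))))) := by
  simp [triSteps]

/-- The symbol of the adjacency operator of the triangular lattice. -/
noncomputable def triSymbol (x y : ℝ) : ℝ := 2 * (Real.cos x + Real.cos y + Real.cos (x + y))

lemma sum_triSteps_cos (x y : ℝ) (z : ℤ × ℤ) :
    ∑ d ∈ triSteps, cos (planePhase x y (z + d)) = triSymbol x y * cos (planePhase x y z) := by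
  have two : ∀ s t : ℝ, cos (s + t) + cos (s - t) = 2 * cos t * cos s := fun s t => by
    rw [cos_add, cos_sub]; ring
  have h1 := two (planePhase x y z) x
  have h2 := two (planePhase x y z) y
  have h3 := two (planePhase x y z) (x + y)
  have e : ∀ d : ℤ × ℤ, planePhase x y (z + d) = planePhase x y z + (d.1 * x + d.2 * y) :=
    fun d => by simp only [planePhase, Prod.fst_add, Prod.snd_add]; push_cast; ring
  simp only [e, sum_triSteps, triSymbol]
  norm_num [← sub_eq_add_neg]
  rw [show planePhase x y z + (-x - y) = planePhase x y z - (x + y) by ring]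
  linarith

lemma sum_triSteps_sin (x y : ℝ) (z : ℤ × ℤ) :
    ∑ d ∈ triSteps, sin (planePhase x y (z + d)) = triSymbol x y * sin (planePhase x y z) := by
  have two : ∀ s t : ℝ, sin (s + t) + sin (s - t) = 2 * cos t * sin s := fun s t => by
    rw [sin_add, sin_sub]; ring
  have h1 := two (planePhase x y z) x
  have h2 := two (planePhase x y z) y
  have h3 := two (planePhase x y z) (x + y)
  have e : ∀ d : ℤ × ℤ, planePhase x y (z + d) = planePhase x y z + (d.1 * x + d.2 * y) :=
    fun d => by simp only [planePhase, Prod.fst_add, Prod.snd_add]; push_cast; ring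
  simp only [e, sum_triSteps, triSymbol]
  norm_num [← sub_eq_add_neg]
  rw [show planePhase x y z + (-x - y) = planePhase x y z - (x + y) by ring]
  linarith

/-- The squared modulus of the inner product of `v` with the plane wave of wave vector `(x, y)`. -/
noncomputable def planeWeight {n m : ℕ} (v : Fin n × Fin m → ℝ) (x y : ℝ) : ℝ :=
  dotProduct v (fun u => cos (planePhase x y (triPos u))) ^ 2
    + dotProduct v (fun u => sin (planePhase x y (triPos u))) ^ 2

lemma planeWeight_eq_sum {n m : ℕ} (v : Fin n × Fin m → ℝ) (x y : ℝ) :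
    planeWeight v x y = ∑ p : (Fin n × Fin m) × (Fin n × Fin m), v p.1 * v p.2 *
      cos (((triPos p.1).1 - (triPos p.2).1 : ℤ) * x
        + ((triPos p.1).2 - (triPos p.2).2 : ℤ) * y) := by
  have e : ∀ z w : ℤ × ℤ, cos (((z.1 - w.1 : ℤ) : ℝ) * x + ((z.2 - w.2 : ℤ) : ℝ) * y)
      = cos (planePhase x y z) * cos (planePhase x y w)
        + sin (planePhase x y z) * sin (planePhase x y w) := by
    intro z w
    rw [← cos_sub]
    congr 1
    simp only [planePhase]
    push_cast
    ring
  simp only [planeWeight, dotProduct, sq, Finset.sum_mul_sum, e, Fintype.sum_prod_type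
    (α₁ := Fin n × Fin m) (α₂ := Fin n × Fin m), ← Finset.sum_add_distrib]
  refine Finset.sum_congr rfl fun _ _ => Finset.sum_congr rfl fun _ _ => by ring

lemma iterated_integral_planeWeight {n m : ℕ} (v : Fin n × Fin m → ℝ) :
    ∫ x in (0:ℝ)..2 * π, ∫ y in (0:ℝ)..2 * π, planeWeight v x y = 4 * π ^ 2 * ∑ u, v u ^ 2 := by
  simp_rw [planeWeight_eq_sum]
  rw [iterated_integral_sum _ _ _ fun p _ => by unfold Function.uncurry; fun_prop]
  simp_rw [iterated_integral_cos_int]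
  rw [Fintype.sum_prod_type, Finset.mul_sum]
  refine Finset.sum_congr rfl fun u _ => ?_
  rw [Finset.sum_eq_single u]
  · simp; ring
  · intro w _ hw
    rw [if_neg, mul_zero]
    rintro ⟨h1, h2⟩
    exact hw (triPos_injective (Prod.ext (sub_eq_zero.1 h1).symm (sub_eq_zero.1 h2).symm))
  · simp

lemma continuous_planeWeight {n m : ℕ} (v : Fin n × Fin m → ℝ) :
    Continuous (Function.uncurry (planeWeight v)) := by
  unfold Function.uncurry planeWeight planePhase dotProduct
  fun_prop

lemma continuous_triSymbol : Continuous (Function.uncurry triSymbol) := by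
  unfold Function.uncurry triSymbol
  fun_prop

lemma abs_sum_planeWeight_sub_le {n m : ℕ} [DecidableRel (triFree n m).Adj]
    (hA : ((triFree n m).adjMatrix ℝ).IsHermitian) (x y : ℝ) :
    |∑ k, planeWeight (hA.eigenvectorBasis k) x y * |hA.eigenvalues k|
        - (n * m : ℝ) * (|triSymbol x y|)| ≤ √((n * m : ℝ) * (144 * (n + m))) := by
  have hN : ∑ k, planeWeight (hA.eigenvectorBasis k) x y = (n * m : ℝ) := by
    simp only [planeWeight, Finset.sum_add_distrib, sum_sq_eigenvectorBasis_dotProduct]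
    simp [← Finset.sum_add_distrib]
  have hE : ∑ k, planeWeight (hA.eigenvectorBasis k) x y
      * (hA.eigenvalues k - triSymbol x y) ^ 2 ≤ 144 * (n + m) := by
    simp only [planeWeight, add_mul, Finset.sum_add_distrib, sum_eigenvalue_sub_sq_mul]
    have h1 := sum_sq_adjMatrix_triFree_sub_le (n := n) (m := m)
      (fun z => cos (planePhase x y z)) (fun z => abs_cos_le_one _) _ (sum_triSteps_cos x y)
    have h2 := sum_sq_adjMatrix_triFree_sub_le (n := n) (m := m)
      (fun z => sin (planePhase x y z)) (fun z => abs_sin_le_one _) _ (sum_triSteps_sin x y)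
    linarith
  have h := abs_sum_mul_abs_sub_le (fun k => planeWeight (hA.eigenvectorBasis k) x y)
    hA.eigenvalues (fun k => by unfold planeWeight; positivity) (triSymbol x y)
  rw [hN] at h
  exact h.trans (Real.sqrt_le_sqrt (mul_le_mul_of_nonneg_left hE (by positivity)))

lemma abs_iterated_integral_le {g : ℝ → ℝ → ℝ} {C : ℝ} (hg : ∀ x y, |g x y| ≤ C) :
    |∫ x in (0:ℝ)..2 * π, ∫ y in (0:ℝ)..2 * π, g x y| ≤ 4 * π ^ 2 * C := by
  have inner : ∀ x, ‖∫ y in (0:ℝ)..2 * π, g x y‖ ≤ C * |2 * π - 0| := fun x =>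
    intervalIntegral.norm_integral_le_of_norm_le_const fun y _ => hg x y
  have h := intervalIntegral.norm_integral_le_of_norm_le_const (a := 0) (b := 2 * π)
    fun x _ => inner x
  rw [sub_zero, abs_of_pos Real.two_pi_pos, Real.norm_eq_abs] at h
  linarith

lemma abs_graphEnergy_triFree_sub_le (n m : ℕ) :
    |4 * π ^ 2 * graphEnergy (triFree n m)
        - (n * m : ℝ) * ∫ x in (0:ℝ)..2 * π, (∫ y in (0:ℝ)..2 * π, |triSymbol x y|)|
      ≤ 4 * π ^ 2 * √((n * m : ℝ) * (144 * (n + m))) := by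
  let _ := Classical.decRel (triFree n m).Adj
  set hA := adjMatrix_isHermitian (triFree n m)
  have h := abs_iterated_integral_le (abs_sum_planeWeight_sub_le hA)
  have hcont : ∀ o ∈ (Finset.univ : Finset (Option (Fin n × Fin m))),
      Continuous (Function.uncurry (o.elim (fun x y => |triSymbol x y|)
        fun k => planeWeight (hA.eigenvectorBasis k))) := by
    rintro (_ | k) _
    · exact continuous_triSymbol.abs
    · exact continuous_planeWeight _
  have hlin := iterated_integral_sum Finset.univ
    (fun o : Option (Fin n × Fin m) => o.elim (-(n * m : ℝ)) fun k => |hA.eigenvalues k|)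
    _ hcont 0 (2 * π)
  have hone : ∀ k, ∑ u, (hA.eigenvectorBasis k) u ^ 2 = (1 : ℝ) := by
    intro k
    have := EuclideanSpace.norm_sq_eq (hA.eigenvectorBasis k)
    simpa [hA.eigenvectorBasis.orthonormal.1 k] using this.symm
  simp only [Fintype.sum_option, Option.elim_none, Option.elim_some,
    iterated_integral_planeWeight, hone, mul_one] at hlin
  have hint : (∫ x in (0:ℝ)..2 * π, ∫ y in (0:ℝ)..2 * π,
      (∑ k, planeWeight (hA.eigenvectorBasis k) x y * |hA.eigenvalues k|
        - (n * m : ℝ) * |triSymbol x y|)) = 4 * π ^ 2 * graphEnergy (triFree n m)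
        - (n * m : ℝ) * ∫ x in (0:ℝ)..2 * π, ∫ y in (0:ℝ)..2 * π, |triSymbol x y| := by
    rw [← Finset.sum_mul] at hlin
    have hE : graphEnergy (triFree n m) = ∑ k, |hA.eigenvalues k| := rfl
    rw [hE, mul_comm (4 * π ^ 2), sub_eq_neg_add, ← neg_mul, ← hlin]
    simp only [sub_eq_neg_add, ← neg_mul, mul_comm (|hA.eigenvalues _|)]
  rwa [hint] at h

/-- the energy per vertex of the free-boundary triangular lattice
converges, as `n, m → ∞` jointly, to
`(1/(2π²)) ∫₀^{2π} ∫₀^{2π} |cos x + cos y + cos(x+y)| dx dy`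
(the same value as for the toroidal boundary condition). -/
theorem energy_per_vertex_triFree :
    Tendsto (fun p : ℕ × ℕ => graphEnergy (triFree p.1 p.2) / ((p.1 : ℝ) * (p.2 : ℝ)))
      (atTop ×ˢ atTop)
      (nhds ((1 / (2 * π ^ 2)) *
        ∫ x in (0:ℝ)..2 * π, ∫ y in (0:ℝ)..2 * π,
          |Real.cos x + Real.cos y + Real.cos (x + y)|)) := by
  set I := ∫ x in (0:ℝ)..2 * π, ∫ y in (0:ℝ)..2 * π,
    |Real.cos x + Real.cos y + Real.cos (x + y)| with hI
  have hsym : ∫ x in (0:ℝ)..2 * π, ∫ y in (0:ℝ)..2 * π, |triSymbol x y| = 2 * I := by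
    simp [triSymbol, abs_mul, intervalIntegral.integral_const_mul, hI]
  have hlim : Tendsto (fun p : ℕ × ℕ => √(144 * ((p.1 : ℝ)⁻¹ + (p.2 : ℝ)⁻¹)))
      (atTop ×ˢ atTop) (nhds 0) := by
    have h0 : Tendsto (fun k : ℕ => (k : ℝ)⁻¹) atTop (nhds 0) :=
      tendsto_inv_atTop_nhds_zero_nat
    have h : Tendsto (fun p : ℕ × ℕ => 144 * ((p.1 : ℝ)⁻¹ + (p.2 : ℝ)⁻¹)) (atTop ×ˢ atTop)
        (nhds (144 * (0 + 0))) :=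
      ((h0.comp tendsto_fst).add (h0.comp tendsto_snd)).const_mul _
    simpa using h.sqrt
  rw [tendsto_iff_dist_tendsto_zero]
  refine squeeze_zero' (Eventually.of_forall fun _ => dist_nonneg) ?_ hlim
  filter_upwards [(eventually_gt_atTop 0).prod_mk (eventually_gt_atTop 0)] with p hp
  obtain ⟨n, m⟩ := p
  have hn : (0 : ℝ) < n := by exact_mod_cast hp.1
  have hm : (0 : ℝ) < m := by exact_mod_cast hp.2
  have h := abs_graphEnergy_triFree_sub_le n m
  have hsqrt : √((n * m : ℝ) * (144 * (n + m)))
      = (n * m) * √(144 * ((n : ℝ)⁻¹ + (m : ℝ)⁻¹)) := by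
    rw [show (n * m : ℝ) * (144 * (n + m)) = (n * m) ^ 2 * (144 * ((n : ℝ)⁻¹ + (m : ℝ)⁻¹)) by
      field_simp; ring, Real.sqrt_mul (by positivity), Real.sqrt_sq (by positivity)]
  have hpos : (0 : ℝ) < 4 * π ^ 2 * (n * m) := by positivity
  rw [hsym, hsqrt, ← mul_assoc (4 * π ^ 2)] at h
  rw [Real.dist_eq, ← mul_le_mul_iff_right₀ hpos]
  refine le_trans (le_of_eq ?_) h
  rw [← abs_of_pos hpos, ← abs_mul]
  congr 1
  field_simp
  ring
end

section
/- For the cylindrical triangular lattice T^c(n,m), the energy per vertex converges as n, m → ∞ (jointly, i.e., along the product filter): lim_{n,m→∞} E(T^c(n,m))/(nm) = (1/(2π²)) ∫₀^{2π} ∫₀^{2π} |cos x + cos y + cos(x+y)| dx dy. In particular the triangular lattices with cylindrical and toroidal boundary conditions have the same asymptotic energy per vertex. -/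
open Real Filter SimpleGraph

/-- The cylindrical triangular lattice `T^c(n,m)`: the simple graph on
`{0,…,n−1} × (ℤ/mℤ)` in which `(i,j)` is adjacent to `(i,j±1)` (mod `m`),
to `(i+1,j)` and to `(i+1,j+1)` (when `i+1 ≤ n−1`, second coordinate mod `m`). -/
def triCyl (n m : ℕ) : SimpleGraph (Fin n × ZMod m) :=
  SimpleGraph.fromRel fun u v =>
    (v.1 = u.1 ∧ v.2 = u.2 + 1) ∨
      ((v.1 : ℕ) = (u.1 : ℕ) + 1 ∧ v.2 = u.2) ∨
      ((v.1 : ℕ) = (u.1 : ℕ) + 1 ∧ v.2 = u.2 + 1)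

/-- The energy of `T^c(n,m)` as a function of `n, m` (junk value `0` when `m = 0`,
where `ℤ/mℤ` is infinite). -/
noncomputable def triCylEnergy : ℕ → ℕ → ℝ
  | _, 0 => 0
  | n, m + 1 => graphEnergy (triCyl n (m + 1))

open Matrix in
/-- If an invertible complex matrix `U` diagonalizes the adjacency matrix of `G`, with real
diagonal entries `d`, then the energy of `G` is the sum of the absolute values of `d`. -/
theorem graphEnergy_eq_of_adjMatrix_mul_eq {V : Type*} [Fintype V] [DecidableEq V]
    (G : SimpleGraph V) [DecidableRel G.Adj] (U : Matrix V V ℂ) (d : V → ℝ) (hU : IsUnit U)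
    (h : G.adjMatrix ℂ * U = U * diagonal (fun v => (d v : ℂ))) :
    graphEnergy G = ∑ v, |d v| := by
  obtain ⟨W, rfl⟩ := hU
  have hA : (G.adjMatrix ℂ) = W.val * diagonal (fun v => (d v : ℂ)) * W⁻¹.val := by
    rw [← h, mul_assoc, Units.mul_inv, mul_one]
  have hmap : (G.adjMatrix ℂ) = (G.adjMatrix ℝ).map (algebraMap ℝ ℂ) := by
    ext u v
    by_cases huv : G.Adj u v <;> simp [adjMatrix_apply, huv]
  have hd : (G.adjMatrix ℂ).charpoly = ∏ v, (Polynomial.X - Polynomial.C (d v : ℂ)) := by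
    rw [hA, Matrix.coe_units_inv, Matrix.charpoly_units_conj, Matrix.charpoly_diagonal]
  have he : (G.adjMatrix ℂ).charpoly =
      ∏ v, (Polynomial.X - Polynomial.C (graphEigenvalues G v : ℂ)) := by
    rw [hmap, Matrix.charpoly_map, (adjMatrix_isHermitian G).charpoly_eq, Polynomial.map_prod]
    refine Finset.prod_congr rfl fun v _ => ?_
    simp only [Polynomial.map_sub, Polynomial.map_X, Polynomial.map_C, RCLike.ofReal_real_eq_id, id]
    unfold graphEigenvalues
    congr!
  have hroots : Finset.univ.val.map (fun v => (graphEigenvalues G v : ℂ)) =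
      Finset.univ.val.map (fun v => (d v : ℂ)) := by
    rw [← Polynomial.roots_multiset_prod_X_sub_C (Finset.univ.val.map fun v => (d v : ℂ)),
      ← Polynomial.roots_multiset_prod_X_sub_C
        (Finset.univ.val.map fun v => (graphEigenvalues G v : ℂ)), Multiset.map_map,
      Multiset.map_map]
    exact congrArg Polynomial.roots (he.symm.trans hd)
  have := congrArg (fun s => (Multiset.map (fun z : ℂ => ‖z‖) s).sum) hroots
  simpa [Multiset.map_map, graphEnergy] using this

lemma sum_ite_val_eq_succ {n : ℕ} (g : ℕ → ℂ) (hg : g (n + 1) = 0) (i : Fin n) :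
    ∑ i' : Fin n, (if (i' : ℕ) = i + 1 then g (i' + 1) else 0) = g (i + 2) := by
  by_cases h : (i : ℕ) + 1 < n
  · rw [Finset.sum_eq_single ⟨i + 1, h⟩]
    · simp
    · intro b _ hb
      rw [if_neg]
      exact fun h' => hb (Fin.ext h')
    · simp
  · have hi : (i : ℕ) + 2 = n + 1 := by have := i.2; omega
    rw [hi, hg]
    refine Finset.sum_eq_zero fun b _ => if_neg ?_
    have := b.2
    omega

lemma sum_ite_eq_val_succ {n : ℕ} (g : ℕ → ℂ) (hg : g 0 = 0) (i : Fin n) :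
    ∑ i' : Fin n, (if (i : ℕ) = i' + 1 then g (i' + 1) else 0) = g i := by
  rcases Nat.eq_zero_or_pos (i : ℕ) with h | h
  · rw [h, hg]
    exact Finset.sum_eq_zero fun b _ => if_neg (by omega)
  · have hi := i.2
    rw [Finset.sum_eq_single ⟨i - 1, by omega⟩]
    · have : (i : ℕ) - 1 + 1 = i := by omega
      simp [this]
    · intro b _ hb
      rw [if_neg]
      exact fun h' => hb (Fin.ext (by simp; omega))
    · simp

/-- The angle `2πk/m` of the `k`-th character of `ℤ/mℤ`. -/
noncomputable def cycleAngle {m : ℕ} (k : ZMod m) : ℝ := 2 * π * (k.val : ℝ) / m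

/-- The angle `π(l+1)/(n+1)` of the `l`-th eigenvector of the path on `n` vertices. -/
noncomputable def pathAngle {n : ℕ} (l : Fin n) : ℝ := π * ((l : ℝ) + 1) / ((n : ℝ) + 1)

/-- The eigenvector of the path on `n` vertices for the angle `pathAngle l`, extended to `ℕ` so
that vertex `i` carries the value at `i + 1`. -/
noncomputable def pathMode {n : ℕ} (l : Fin n) (a : ℕ) : ℂ := (Real.sin (pathAngle l * a) : ℂ)

lemma pathMode_zero {n : ℕ} (l : Fin n) : pathMode l 0 = 0 := by simp [pathMode]

lemma pathMode_last {n : ℕ} (l : Fin n) : pathMode l (n + 1) = 0 := by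
  have h : pathAngle l * ((n + 1 : ℕ) : ℝ) = ((l + 1 : ℕ) : ℝ) * π := by
    unfold pathAngle
    push_cast
    field_simp
  rw [pathMode, h, Real.sin_nat_mul_pi, Complex.ofReal_zero]

lemma pathMode_add_two {n : ℕ} (l : Fin n) (a : ℕ) :
    pathMode l (a + 2) + pathMode l a = 2 * Real.cos (pathAngle l) * pathMode l (a + 1) := by
  unfold pathMode
  norm_cast
  have h₁ : pathAngle l * ((a + 2 : ℕ) : ℝ) =
      pathAngle l * ((a + 1 : ℕ) : ℝ) + pathAngle l := by push_cast; ring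
  have h₂ : pathAngle l * (a : ℝ) = pathAngle l * ((a + 1 : ℕ) : ℝ) - pathAngle l := by
    push_cast; ring
  rw [h₁, h₂, Real.sin_add, Real.sin_sub]
  ring

lemma pathAngle_mem_Ioo {n : ℕ} (l : Fin n) : pathAngle l ∈ Set.Ioo 0 π := by
  have hl : ((l : ℕ) : ℝ) + 1 ≤ n := by exact_mod_cast l.2
  unfold pathAngle
  refine ⟨by positivity, ?_⟩
  rw [div_lt_iff₀ (by positivity)]
  nlinarith [Real.pi_pos]

lemma pathAngle_injective {n : ℕ} : Function.Injective (pathAngle (n := n)) := by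
  intro l l' h
  unfold pathAngle at h
  have hn : ((n : ℝ) + 1) ≠ 0 := by positivity
  have h' := mul_left_cancel₀ Real.pi_ne_zero ((div_left_inj' hn).1 h)
  exact Fin.ext (by exact_mod_cast add_right_cancel h')

lemma pathMode_linearIndependent (n : ℕ) :
    LinearIndependent ℂ (fun l : Fin n => fun i : Fin n => pathMode l (i + 1)) := by
  let P : Matrix (Fin n) (Fin n) ℂ := Matrix.of fun i i' =>
    (if (i' : ℕ) = i + 1 then 1 else 0) + (if (i : ℕ) = i' + 1 then 1 else 0)
  refine Module.End.eigenvectors_linearIndependent' (Matrix.toLin' P)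
    (fun l => ((2 * Real.cos (pathAngle l) : ℝ) : ℂ)) ?_ _ fun l => ⟨?_, ?_⟩
  · intro l l' h
    have h' := Complex.ofReal_injective h
    refine pathAngle_injective (Real.injOn_cos ?_ ?_ (by linarith))
    · exact Set.Ioo_subset_Icc_self (pathAngle_mem_Ioo l)
    · exact Set.Ioo_subset_Icc_self (pathAngle_mem_Ioo l')
  · rw [Module.End.mem_eigenspace_iff]
    ext i
    simp only [Matrix.toLin'_apply, Matrix.mulVec, dotProduct, P, Matrix.of_apply, add_mul,
      ite_mul, one_mul, zero_mul, Finset.sum_add_distrib, Pi.smul_apply, smul_eq_mul]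
    rw [sum_ite_val_eq_succ _ (pathMode_last l), sum_ite_eq_val_succ _ (pathMode_zero l),
      pathMode_add_two]
    push_cast
    ring
  · intro h
    have h0 := congrFun h ⟨0, l.pos⟩
    have := Real.sin_pos_of_mem_Ioo (pathAngle_mem_Ioo l)
    simp [pathMode] at h0
    norm_cast at h0
    exact this.ne' h0

open Classical in
lemma adjMatrix_triCyl_apply {n m : ℕ} (hm : 3 ≤ m) (u v : Fin n × ZMod m) :
    (triCyl n m).adjMatrix ℂ u v =
      (if v.1 = u.1 then 1 else 0) *
          ((if v.2 = u.2 + 1 then 1 else 0) + (if v.2 = u.2 - 1 then 1 else 0)) +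
        (if (v.1 : ℕ) = u.1 + 1 then 1 else 0) *
          ((if v.2 = u.2 then 1 else 0) + (if v.2 = u.2 + 1 then 1 else 0)) +
        (if (u.1 : ℕ) = v.1 + 1 then 1 else 0) *
          ((if v.2 = u.2 then 1 else 0) + (if v.2 = u.2 - 1 then 1 else 0)) := by
  have h1 : (1 : ZMod m) ≠ 0 := by
    intro h
    have := (ZMod.natCast_eq_zero_iff 1 m).1 (by exact_mod_cast h)
    have := Nat.le_of_dvd one_pos this
    omega
  have h2 : (1 + 1 : ZMod m) ≠ 0 := by
    intro h
    have := (ZMod.natCast_eq_zero_iff 2 m).1 (by push_cast; rw [← h]; norm_num)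
    have := Nat.le_of_dvd two_pos this
    omega
  obtain ⟨i, j⟩ := u
  obtain ⟨i', j'⟩ := v
  have hadd : ∀ a b : ZMod m, a = b + 1 ↔ b = a - 1 := fun a b =>
    ⟨fun h => by rw [h, add_sub_cancel_right], fun h => by rw [h, sub_add_cancel]⟩
  have e1 : j + 1 ≠ j := fun h => h1 (by simpa using h)
  have e2 : j - 1 ≠ j := fun h => h1 (by simpa using h)
  have e3 : j + 1 ≠ j - 1 := fun h => h2 (by linear_combination h)
  have e4 : j' = j - 1 ↔ j = j' + 1 := (hadd j j').symm
  have e5 : j' = j ↔ j = j' := eq_comm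
  have e6 : (i' : ℕ) = i ↔ (i : ℕ) = i' := eq_comm
  have e7 : ∀ a : ℕ, ¬ a = a + 1 + 1 := fun a => by omega
  simp only [adjMatrix_apply, triCyl, fromRel_adj, ne_eq, Prod.mk.injEq, Fin.ext_iff]
  by_cases hi : (i' : ℕ) = i
  · by_cases hj : j' = j + 1
    · subst hj; simp [hi, h1, e3]
    · by_cases hj' : j' = j - 1
      · subst hj'; simp [hi, h1, e3.symm, e2.symm]
      · simp [hi, hj, hj', ← e4]
  · have hi' : ¬ (i : ℕ) = i' := fun h => hi h.symm
    rcases lt_trichotomy (i' : ℕ) (i + 1) with h | h | h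
    · have h' : ¬ (i' : ℕ) = i + 1 := h.ne
      by_cases h'' : (i : ℕ) = i' + 1
      · by_cases hj : j' = j
        · subst hj; simp [h'', e2.symm, e7]
        · simp [h'', ← e4, ← e5, hj, e7]
      · simp [hi, hi', h', h'']
    · have h' : ¬ (i : ℕ) = i' + 1 := by omega
      by_cases hj : j' = j
      · subst hj; simp [h, e1.symm, e7]
      · simp [h, hj, e7]
    · have h' : ¬ (i' : ℕ) = i + 1 := h.ne'
      have h'' : ¬ (i : ℕ) = i' + 1 := by omega
      simp [hi, hi', h', h'']

/-- The eigenvectors of the cylindrical triangular lattice, as columns of a matrix: products of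
an eigenvector of the path, a character of `ℤ/mℤ`, and a phase linear in the path coordinate. -/
noncomputable def triCylModes (n m : ℕ) [NeZero m] :
    Matrix (Fin n × ZMod m) (Fin n × ZMod m) ℂ :=
  Matrix.of fun u p => ZMod.stdAddChar (p.2 * u.2) *
    (Complex.exp (-(cycleAngle p.2 / 2 * Complex.I)) ^ ((u.1 : ℕ) + 1) *
      pathMode p.1 (u.1 + 1))

/-- The function of the two angles whose values are the eigenvalues of `T^c(n,m)`. -/
noncomputable def triCylSymbol (θ φ : ℝ) : ℝ :=
  2 * Real.cos θ + 4 * Real.cos (θ / 2) * Real.cos φ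

lemma stdAddChar_eq_exp_cycleAngle {m : ℕ} [NeZero m] (k : ZMod m) :
    ZMod.stdAddChar k = Complex.exp (cycleAngle k * Complex.I) := by
  rw [ZMod.stdAddChar_apply, ZMod.toCircle_apply]
  congr 1
  simp only [cycleAngle]
  push_cast
  ring

lemma isUnit_triCylModes (n m : ℕ) [NeZero m] : IsUnit (triCylModes n m) := by
  rw [Matrix.isUnit_iff_isUnit_det, isUnit_iff_ne_zero]
  intro hdet
  obtain ⟨c, hc, h⟩ := Matrix.exists_mulVec_eq_zero_iff.2 hdet
  refine hc (funext fun p => ?_)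
  have hpath : ∀ (i : Fin n) (k : ZMod m),
      ∑ l, c (l, k) * pathMode l (i + 1) = 0 := by
    intro i k
    let Φ : ZMod m → ℂ := fun k => ∑ l, c (l, k) *
      (Complex.exp (-(cycleAngle k / 2 * Complex.I)) ^ ((i : ℕ) + 1) * pathMode l (i + 1))
    have hΦ : ZMod.dft.symm Φ = 0 := by
      ext j
      have hij := congrFun h (i, j)
      simp only [Matrix.mulVec, dotProduct, triCylModes, Matrix.of_apply,
        Fintype.sum_prod_type_right, Pi.zero_apply] at hij
      rw [ZMod.invDFT_apply, Pi.zero_apply]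
      refine smul_eq_zero_of_right _ (Eq.trans ?_ hij)
      refine Finset.sum_congr rfl fun k _ => ?_
      simp only [Φ, smul_eq_mul, Finset.mul_sum]
      exact Finset.sum_congr rfl fun l _ => by ring
    have hΦk : Φ k = 0 := by
      rw [LinearEquiv.map_eq_zero_iff] at hΦ
      rw [hΦ, Pi.zero_apply]
    have hexp : Complex.exp (-(cycleAngle k / 2 * Complex.I)) ^ ((i : ℕ) + 1) ≠ 0 :=
      pow_ne_zero _ (Complex.exp_ne_zero _)
    refine (mul_eq_zero.1 (Eq.trans ?_ hΦk)).resolve_left hexp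
    simp only [Φ, Finset.mul_sum]
    exact Finset.sum_congr rfl fun l _ => by ring
  refine Fintype.linearIndependent_iff.1 (pathMode_linearIndependent n) (fun l => c (l, p.2))
    (funext fun i => ?_) p.1
  simpa [Finset.sum_apply] using hpath i p.2

open Classical in
lemma adjMatrix_triCyl_mul_triCylModes {n m : ℕ} [NeZero m] (hm : 3 ≤ m) :
    (triCyl n m).adjMatrix ℂ * triCylModes n m = triCylModes n m * Matrix.diagonal
      (fun p => (triCylSymbol (cycleAngle p.2) (pathAngle p.1) : ℂ)) := by
  ext u p
  obtain ⟨i, j⟩ := u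
  obtain ⟨l, k⟩ := p
  rw [Matrix.mul_diagonal, Matrix.mul_apply, Fintype.sum_prod_type]
  set z := Complex.exp (-(cycleAngle k / 2 * Complex.I)) with hz
  set g : ℕ → ℂ := fun a => z ^ a * pathMode l a with hg
  have hg0 : g 0 = 0 := by simp [hg, pathMode_zero]
  have hgn : g (n + 1) = 0 := by simp [hg, pathMode_last]
  have hz0 : z ≠ 0 := Complex.exp_ne_zero _
  have hω : ZMod.stdAddChar k * z ^ 2 = 1 := by
    rw [stdAddChar_eq_exp_cycleAngle, hz, ← Complex.exp_nat_mul, ← Complex.exp_add]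
    convert Complex.exp_zero using 2
    push_cast
    ring
  have hmodes : ∀ (i' : Fin n) (j' : ZMod m),
      triCylModes n m (i', j') (l, k) = ZMod.stdAddChar (k * j') * g (i' + 1) :=
    fun _ _ => rfl
  simp only [adjMatrix_triCyl_apply hm, hmodes]
  have hcol : ∀ (a b c : ℂ) (F : ZMod m → ℂ), ∑ j' : ZMod m,
      (a * ((if j' = j + 1 then 1 else 0) + (if j' = j - 1 then 1 else 0)) +
        b * ((if j' = j then 1 else 0) + (if j' = j + 1 then 1 else 0)) +
        c * ((if j' = j then 1 else 0) + (if j' = j - 1 then 1 else 0))) * F j' =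
      a * (F (j + 1) + F (j - 1)) + b * (F j + F (j + 1)) + c * (F j + F (j - 1)) := by
    intro a b c F
    simp only [add_mul, mul_add, Finset.sum_add_distrib, mul_assoc, ← Finset.mul_sum, ite_mul,
      one_mul, zero_mul, Finset.sum_ite_eq', Finset.mem_univ, if_true]
  have hrow : ∀ i' : Fin n, ∑ j' : ZMod m,
      ((if i' = i then 1 else 0) *
          ((if j' = j + 1 then 1 else 0) + (if j' = j - 1 then 1 else 0)) +
        (if (i' : ℕ) = i + 1 then 1 else 0) *
          ((if j' = j then 1 else 0) + (if j' = j + 1 then 1 else 0)) +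
        (if (i : ℕ) = i' + 1 then 1 else 0) *
          ((if j' = j then 1 else 0) + (if j' = j - 1 then 1 else 0)) : ℂ) *
      (ZMod.stdAddChar (k * j') * g (i' + 1)) =
      ZMod.stdAddChar (k * j) *
        ((ZMod.stdAddChar k + ZMod.stdAddChar (-k)) * (if i' = i then g (i' + 1) else 0) +
        (1 + ZMod.stdAddChar k) * (if (i' : ℕ) = i + 1 then g (i' + 1) else 0) +
        (1 + ZMod.stdAddChar (-k)) * (if (i : ℕ) = i' + 1 then g (i' + 1) else 0)) := by
    intro i'
    rw [hcol _ _ _ fun j' => ZMod.stdAddChar (k * j') * g (i' + 1)]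
    simp only [sub_eq_add_neg, mul_add, AddChar.map_add_eq_mul, mul_one, mul_neg]
    split_ifs <;> ring
  simp only [hrow, ← Finset.mul_sum, Finset.sum_add_distrib]
  rw [sum_ite_val_eq_succ g hgn, sum_ite_eq_val_succ g hg0]
  simp only [Finset.sum_ite_eq', Finset.mem_univ, if_true]
  have hcos : (triCylSymbol (cycleAngle k) (pathAngle l) : ℂ) =
      z ^ 2 + (z ^ 2)⁻¹ + (z + z⁻¹) * (2 * Real.cos (pathAngle l)) := by
    have h1 : z + z⁻¹ = 2 * Real.cos (cycleAngle k / 2) := by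
      rw [hz, ← Complex.exp_neg, neg_neg, Complex.ofReal_cos, Complex.cos]
      push_cast
      ring_nf
    have h2 : z ^ 2 + (z ^ 2)⁻¹ = 2 * Real.cos (cycleAngle k) := by
      rw [hz, ← Complex.exp_nat_mul, ← Complex.exp_neg, Complex.ofReal_cos, Complex.cos]
      push_cast
      ring_nf
    rw [h1, h2, triCylSymbol]
    push_cast
    ring
  have hω' : ZMod.stdAddChar k = (z ^ 2)⁻¹ := eq_inv_of_mul_eq_one_left hω
  rw [AddChar.map_neg_eq_inv, hω', inv_inv, hcos]
  simp only [hg]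
  have hrec := pathMode_add_two l (i : ℕ)
  have e : pathMode l ((i : ℕ) + 2) =
    2 * Real.cos (pathAngle l) * pathMode l (i + 1) - pathMode l i := by linear_combination hrec
  rw [e]
  field_simp
  ring

lemma graphEnergy_triCyl {n m : ℕ} [NeZero m] (hm : 3 ≤ m) :
    graphEnergy (triCyl n m) = ∑ k : ZMod m, ∑ l : Fin n,
      |triCylSymbol (cycleAngle k) (pathAngle l)| := by
  classical
  rw [graphEnergy_eq_of_adjMatrix_mul_eq _ _ _ (isUnit_triCylModes n m)
    (adjMatrix_triCyl_mul_triCylModes hm), Fintype.sum_prod_type_right]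

lemma triCylEnergy_eq_sum {n m : ℕ} (hm : 3 ≤ m) :
    triCylEnergy n m = ∑ k ∈ Finset.range m, ∑ l ∈ Finset.range n,
      |triCylSymbol (2 * π * k / m) (π * (l + 1) / (n + 1))| := by
  obtain ⟨m, rfl⟩ : ∃ m', m = m' + 1 := ⟨m - 1, by omega⟩
  have h : triCylEnergy n (m + 1) = graphEnergy (triCyl n (m + 1)) := rfl
  rw [h, graphEnergy_triCyl hm, Finset.sum_range]
  refine Finset.sum_congr rfl fun k _ => ?_
  rw [Finset.sum_range]
  rfl

/-- Riemann sums of a Lipschitz function over a uniform subdivision, with tags in the closed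
subintervals, differ from the integral by at most the mesh times the Lipschitz constant times
the length of the interval. -/
lemma abs_riemannSum_sub_integral_le {f : ℝ → ℝ} {K h : ℝ} (hh : 0 ≤ h)
    (hfc : Continuous f) (hf : ∀ x y, |f x - f y| ≤ K * |x - y|) (hK : 0 ≤ K) (N : ℕ) (ξ : ℕ → ℝ)
    (hξ : ∀ k < N, ξ k ∈ Set.Icc (k * h) ((k + 1 : ℕ) * h)) :
    |h * ∑ k ∈ Finset.range N, f (ξ k) - ∫ x in (0 : ℝ)..N * h, f x| ≤ N * (K * h * h) := by
  have hint : ∫ x in (0 : ℝ)..N * h, f x =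
      ∑ k ∈ Finset.range N, ∫ x in (k * h)..((k + 1 : ℕ) * h), f x := by
    rw [intervalIntegral.sum_integral_adjacent_intervals (a := fun k : ℕ => (k : ℝ) * h)
      fun k _ => hfc.intervalIntegrable _ _]
    simp
  rw [hint, Finset.mul_sum, ← Finset.sum_sub_distrib]
  refine (Finset.abs_sum_le_sum_abs _ _).trans ((Finset.sum_le_card_nsmul _ _ (K * h * h)
    fun k hk => ?_).trans (by simp))
  have hlen : ((k + 1 : ℕ) : ℝ) * h - k * h = h := by push_cast; ring
  have hconst : h * f (ξ k) = ∫ _ in (k * h)..((k + 1 : ℕ) * h), f (ξ k) := by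
    rw [intervalIntegral.integral_const, hlen, smul_eq_mul]
  rw [hconst, ← intervalIntegral.integral_sub intervalIntegrable_const (hfc.intervalIntegrable _ _)]
  have hle : (k : ℝ) * h ≤ (k + 1 : ℕ) * h := by linarith
  have hbound := intervalIntegral.norm_integral_le_of_norm_le_const (a := k * h)
    (b := (k + 1 : ℕ) * h) (f := fun x => f (ξ k) - f x) (C := K * h) fun x hx => ?_
  · rwa [hlen, abs_of_nonneg hh] at hbound
  · rw [Set.uIoc_of_le hle] at hx
    obtain ⟨h1, h2⟩ := hξ k (Finset.mem_range.1 hk)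
    rw [Real.norm_eq_abs]
    refine (hf _ _).trans (mul_le_mul_of_nonneg_left ?_ hK)
    rw [abs_le]
    constructor <;> linarith [hx.1, hx.2]

lemma abs_triCylSymbol_sub_le_left (θ θ' φ : ℝ) :
    |(|triCylSymbol θ φ| - |triCylSymbol θ' φ|)| ≤ 4 * |θ - θ'| := by
  refine (abs_abs_sub_abs_le_abs_sub _ _).trans ?_
  have e : triCylSymbol θ φ - triCylSymbol θ' φ = 2 * (Real.cos θ - Real.cos θ') +
      4 * (Real.cos (θ / 2) - Real.cos (θ' / 2)) * Real.cos φ := by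
    unfold triCylSymbol; ring
  rw [e]
  refine (abs_add_le _ _).trans ?_
  rw [abs_mul, abs_mul, abs_mul, abs_of_pos (two_pos (α := ℝ)), abs_of_pos (four_pos (α := ℝ))]
  have h1 := abs_cos_sub_cos_le θ θ'
  have h2 := abs_cos_sub_cos_le (θ / 2) (θ' / 2)
  rw [← sub_div, abs_div, abs_of_pos (two_pos (α := ℝ))] at h2
  nlinarith [Real.abs_cos_le_one φ, abs_nonneg (Real.cos (θ / 2) - Real.cos (θ' / 2)),
    mul_le_of_le_one_right (abs_nonneg (Real.cos (θ / 2) - Real.cos (θ' / 2)))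
      (Real.abs_cos_le_one φ)]

lemma abs_triCylSymbol_sub_le_right (θ φ φ' : ℝ) :
    |(|triCylSymbol θ φ| - |triCylSymbol θ φ'|)| ≤ 4 * |φ - φ'| := by
  refine (abs_abs_sub_abs_le_abs_sub _ _).trans ?_
  have e : triCylSymbol θ φ - triCylSymbol θ φ' =
      4 * Real.cos (θ / 2) * (Real.cos φ - Real.cos φ') := by
    unfold triCylSymbol; ring
  rw [e, abs_mul, abs_mul, abs_of_pos (four_pos (α := ℝ)), mul_assoc]
  refine mul_le_mul_of_nonneg_left ?_ four_pos.le
  exact (mul_le_of_le_one_left (abs_nonneg _) (Real.abs_cos_le_one _)).trans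
    (abs_cos_sub_cos_le φ φ')

lemma continuous_abs_triCylSymbol : Continuous fun p : ℝ × ℝ => |triCylSymbol p.1 p.2| := by
  unfold triCylSymbol
  fun_prop

lemma continuous_integral_abs_triCylSymbol :
    Continuous fun θ => ∫ φ in (0 : ℝ)..π, |triCylSymbol θ φ| :=
  intervalIntegral.continuous_parametric_intervalIntegral_of_continuous'
    continuous_abs_triCylSymbol 0 π

lemma continuous_abs_triCylSymbol_right (θ : ℝ) : Continuous fun φ => |triCylSymbol θ φ| := by
  unfold triCylSymbol
  fun_prop

lemma abs_integral_triCylSymbol_sub_le (θ θ' : ℝ) :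
    |(∫ φ in (0 : ℝ)..π, |triCylSymbol θ φ|) - (∫ φ in (0 : ℝ)..π, |triCylSymbol θ' φ|)| ≤
      4 * π * |θ - θ'| := by
  rw [← intervalIntegral.integral_sub
    ((continuous_abs_triCylSymbol_right θ).intervalIntegrable _ _)
    ((continuous_abs_triCylSymbol_right θ').intervalIntegrable _ _), ← Real.norm_eq_abs]
  have hbound := intervalIntegral.norm_integral_le_of_norm_le_const (a := 0) (b := π)
    (f := fun φ => |triCylSymbol θ φ| - |triCylSymbol θ' φ|) (C := 4 * |θ - θ'|) fun φ _ => ?_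
  · rw [sub_zero, abs_of_pos Real.pi_pos] at hbound
    linarith
  · rw [Real.norm_eq_abs]
    exact abs_triCylSymbol_sub_le_left θ θ' φ

/-- The energy per vertex of `T^c(n,m)` is within `O(1/n + 1/m)` of an integral. -/
lemma abs_triCylEnergy_sub_integral_le {n m : ℕ} (hn : 1 ≤ n) (hm : 3 ≤ m) :
    |2 * π ^ 2 * (triCylEnergy n m / (n * m)) -
        (∫ θ in (0 : ℝ)..2 * π, ∫ φ in (0 : ℝ)..π, |triCylSymbol θ φ|)| ≤
      8 * π ^ 3 / n + 16 * π ^ 3 / m := by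
  have hn0 : (0 : ℝ) < n := by exact_mod_cast hn
  have hm0 : (0 : ℝ) < m := by exact_mod_cast (by omega : 0 < m)
  have hpi := Real.pi_pos
  set I : ℝ → ℝ := fun θ => ∫ φ in (0 : ℝ)..π, |triCylSymbol θ φ| with hI
  have hinner : ∀ θ, |π / n * ∑ l ∈ Finset.range n, |triCylSymbol θ (π * (l + 1) / (n + 1))| -
      I θ| ≤ 4 * π ^ 2 / n := by
    intro θ
    have := abs_riemannSum_sub_integral_le (f := fun φ => |triCylSymbol θ φ|) (K := 4)
      (h := π / n) (by positivity)
      (continuous_abs_triCylSymbol_right θ)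
      (abs_triCylSymbol_sub_le_right θ) (by norm_num) n (fun l => π * (l + 1) / (n + 1)) ?_
    · rw [mul_div_cancel₀ _ hn0.ne'] at this
      refine this.trans (le_of_eq ?_)
      field_simp
    · intro l hl
      have hl' : (l : ℝ) + 1 ≤ n := by exact_mod_cast hl
      constructor
      · rw [← mul_div_assoc, div_le_div_iff₀ hn0 (by positivity)]
        nlinarith
      · push_cast
        rw [← mul_div_assoc, div_le_div_iff₀ (by positivity) hn0]
        nlinarith [mul_nonneg hpi.le (by positivity : (0 : ℝ) ≤ (l : ℝ) + 1)]
  have houter : |2 * π / m * ∑ k ∈ Finset.range m, I (2 * π * k / m) -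
      ∫ θ in (0 : ℝ)..2 * π, I θ| ≤ 16 * π ^ 3 / m := by
    have := abs_riemannSum_sub_integral_le (f := I) (K := 4 * π) (h := 2 * π / m)
      (by positivity) continuous_integral_abs_triCylSymbol abs_integral_triCylSymbol_sub_le
      (by positivity) m (fun k => 2 * π * k / m) ?_
    · rw [mul_div_cancel₀ _ hm0.ne'] at this
      refine this.trans (le_of_eq ?_)
      field_simp
      ring
    · intro k _
      have e : 2 * π * k / m = k * (2 * π / m) := by ring
      rw [e]
      refine ⟨le_rfl, mul_le_mul_of_nonneg_right (by push_cast; linarith) (by positivity)⟩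
  have hsum : |2 * π ^ 2 * (triCylEnergy n m / (n * m)) -
      2 * π / m * ∑ k ∈ Finset.range m, I (2 * π * k / m)| ≤ 8 * π ^ 3 / n := by
    have e : 2 * π ^ 2 * (triCylEnergy n m / (n * m)) -
        2 * π / m * ∑ k ∈ Finset.range m, I (2 * π * k / m) =
        2 * π / m * ∑ k ∈ Finset.range m, (π / n * ∑ l ∈ Finset.range n,
          |triCylSymbol (2 * π * k / m) (π * (l + 1) / (n + 1))| - I (2 * π * k / m)) := by
      rw [Finset.sum_sub_distrib, ← Finset.mul_sum, ← triCylEnergy_eq_sum hm]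
      field_simp
    rw [e, abs_mul, abs_of_pos (by positivity)]
    calc _ ≤ 2 * π / m * (m * (4 * π ^ 2 / n)) := by
          refine mul_le_mul_of_nonneg_left ?_ (by positivity)
          refine (Finset.abs_sum_le_sum_abs _ _).trans
            ((Finset.sum_le_card_nsmul _ _ _ fun k _ => hinner _).trans (by simp))
      _ = 8 * π ^ 3 / n := by field_simp; ring
  refine (abs_sub_le _ _ _).trans (add_le_add hsum houter)

/-- After a shift of `y` by `x / 2` the integrand becomes even in `y`, so that it suffices to
integrate over half a period. -/
lemma integral_abs_cos_add_cos_add_cos (x : ℝ) :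
    ∫ y in (0 : ℝ)..2 * π, |Real.cos x + Real.cos y + Real.cos (x + y)| =
      ∫ φ in (0 : ℝ)..π, |triCylSymbol x φ| := by
  let F : ℝ → ℝ := fun y => |Real.cos x + 2 * Real.cos (x / 2) * Real.cos y|
  have hF : Continuous F := by fun_prop
  have hper : Function.Periodic F (2 * π) := fun y => by simp only [F, Real.cos_add_two_pi]
  have hshift : ∀ y, |Real.cos x + Real.cos y + Real.cos (x + y)| = F (y + x / 2) := by
    intro y
    have h : ∀ a b, Real.cos (a - b) + Real.cos (a + b) = 2 * Real.cos b * Real.cos a :=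
      fun a b => by rw [Real.cos_sub, Real.cos_add]; ring
    have e : y + x / 2 + x / 2 = x + y := by ring
    have h' := h (y + x / 2) (x / 2)
    rw [add_sub_cancel_right, e] at h'
    rw [add_assoc, h']
  have hreflect : ∫ y in π..2 * π, F y = ∫ y in (0 : ℝ)..π, F y := by
    have h := intervalIntegral.integral_comp_sub_left (a := π) (b := 2 * π) F (2 * π)
    rw [sub_self, two_mul, add_sub_cancel_right, ← two_mul] at h
    rw [← h]
    simp only [F, Real.cos_two_pi_sub]
  have htwo : ∀ φ, |triCylSymbol x φ| = 2 * F φ := by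
    intro φ
    have e : triCylSymbol x φ = 2 * (Real.cos x + 2 * Real.cos (x / 2) * Real.cos φ) := by
      unfold triCylSymbol; ring
    rw [e, abs_mul, abs_of_pos (two_pos (α := ℝ))]
  simp only [hshift, htwo]
  rw [intervalIntegral.integral_comp_add_right F, intervalIntegral.integral_const_mul, zero_add,
    add_comm, hper.intervalIntegral_add_eq (x / 2) 0, zero_add,
    ← intervalIntegral.integral_add_adjacent_intervals (hF.intervalIntegrable 0 π)
      (hF.intervalIntegrable π (2 * π)), hreflect, two_mul]

/-- the energy per vertex of the cylindrical triangular lattice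
converges, as `n, m → ∞` jointly, to
`(1/(2π²)) ∫₀^{2π} ∫₀^{2π} |cos x + cos y + cos(x+y)| dx dy`
(the same value as for the toroidal boundary condition). -/
theorem energy_per_vertex_triCyl :
    Tendsto (fun p : ℕ × ℕ => triCylEnergy p.1 p.2 / ((p.1 : ℝ) * (p.2 : ℝ)))
      (atTop ×ˢ atTop)
      (nhds ((1 / (2 * π ^ 2)) *
        ∫ x in (0:ℝ)..2 * π, ∫ y in (0:ℝ)..2 * π,
          |Real.cos x + Real.cos y + Real.cos (x + y)|)) := by
  simp only [integral_abs_cos_add_cos_add_cos]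
  set J := ∫ θ in (0 : ℝ)..2 * π, ∫ φ in (0 : ℝ)..π, |triCylSymbol θ φ|
  have hpi := Real.pi_pos
  have hlim : Tendsto
      (fun p : ℕ × ℕ => 2 * π ^ 2 * (triCylEnergy p.1 p.2 / ((p.1 : ℝ) * (p.2 : ℝ))))
      (atTop ×ˢ atTop) (nhds J) := by
    rw [tendsto_iff_norm_sub_tendsto_zero]
    have hn : Tendsto (fun p : ℕ × ℕ => 8 * π ^ 3 / (p.1 : ℝ)) (atTop ×ˢ atTop) (nhds 0) :=
      (tendsto_const_div_atTop_nhds_zero_nat (8 * π ^ 3)).comp tendsto_fst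
    have hm : Tendsto (fun p : ℕ × ℕ => 16 * π ^ 3 / (p.2 : ℝ)) (atTop ×ˢ atTop) (nhds 0) :=
      (tendsto_const_div_atTop_nhds_zero_nat (16 * π ^ 3)).comp tendsto_snd
    have hsum := hn.add hm
    rw [add_zero] at hsum
    refine squeeze_zero' (Eventually.of_forall fun _ => norm_nonneg _) ?_ hsum
    filter_upwards [(eventually_ge_atTop 1).prod_mk (eventually_ge_atTop 3)] with p hp
    exact abs_triCylEnergy_sub_integral_le hp.1 hp.2
  refine (hlim.const_mul (1 / (2 * π ^ 2))).congr fun p => ?_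
  field_simp
end

section
/- Let n, m ≥ 3 and let S^t(n,2m) be the toroidal 3³.4² lattice. Then the multiset of eigenvalues (with multiplicity) of the adjacency matrix of S^t(n,2m) equals the multiset { 2cos(2πi/n) + ε·sqrt(3 + 2cos(2πi/n) + 2cos(2πj/m) + 2cos(2πi/n + 2πj/m)) : 0 ≤ i ≤ n−1, 0 ≤ j ≤ m−1, ε ∈ {+1, −1} }. -/
open Real Filter SimpleGraph

/-- The toroidal `3³.4²` lattice `S^t(n,2m)`: the simple graph on
`(ℤ/nℤ) × (ℤ/mℤ) × {0,1}` in which `(i,j,0)` is adjacent to `(i,j,1)`,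
`(i,j−1,1)` and `(i±1,j,0)`, and `(i,j,1)` is adjacent additionally to
`(i±1,j,1)` and to `(i−1,j,0)`. -/
def sqTriTorus (n m : ℕ) : SimpleGraph (ZMod n × ZMod m × Bool) :=
  SimpleGraph.fromRel fun u v =>
    (u.2.2 = false ∧ v.2.2 = true ∧ v.1 = u.1 ∧ v.2.1 = u.2.1) ∨
      (u.2.2 = false ∧ v.2.2 = true ∧ v.1 = u.1 ∧ v.2.1 = u.2.1 - 1) ∨
      (u.2.2 = false ∧ v.2.2 = false ∧ v.1 = u.1 + 1 ∧ v.2.1 = u.2.1) ∨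
      (u.2.2 = true ∧ v.2.2 = true ∧ v.1 = u.1 + 1 ∧ v.2.1 = u.2.1) ∨
      (u.2.2 = true ∧ v.2.2 = false ∧ v.1 = u.1 - 1 ∧ v.2.1 = u.2.1)

/-- Intertwined square matrices, with invertible intertwiner, have equal characteristic
polynomials. -/
lemma charpoly_eq_of_mul_eq_mul {ι K : Type*} [Fintype ι] [DecidableEq ι] [Field K]
    {A B F : Matrix ι ι K} (hF : F.det ≠ 0) (h : A * F = F * B) : A.charpoly = B.charpoly := by
  have hu : IsUnit F.det := hF.isUnit
  have hA : A = F * B * F⁻¹ := by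
    rw [← h, Matrix.mul_assoc, Matrix.mul_nonsing_inv _ hu, Matrix.mul_one]
  rw [hA, Matrix.charpoly_mul_comm, ← Matrix.mul_assoc, Matrix.nonsing_inv_mul _ hu,
    Matrix.one_mul]

lemma charpoly_blockDiagonal {ι κ R : Type*} [Fintype ι] [DecidableEq ι] [Fintype κ]
    [DecidableEq κ] [CommRing R] (M : κ → Matrix ι ι R) :
    (Matrix.blockDiagonal M).charpoly = ∏ k, (M k).charpoly := by
  simp only [Matrix.charpoly]
  rw [← Matrix.det_blockDiagonal]
  congr 1
  ext ⟨i, k⟩ ⟨j, l⟩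
  by_cases hkl : k = l
  · subst hkl
    by_cases hij : i = j
    · subst hij
      simp [Matrix.blockDiagonal_apply]
    · simp [Matrix.blockDiagonal_apply, hij]
  · simp [Matrix.blockDiagonal_apply, hkl]

/-- The character table of `ℤ/nℤ`. -/
noncomputable def fourierMatrix (n : ℕ) [NeZero n] : Matrix (ZMod n) (ZMod n) ℂ :=
  Matrix.of fun x a => ZMod.stdAddChar (x * a)

lemma det_fourierMatrix_ne_zero (n : ℕ) [NeZero n] : (fourierMatrix n).det ≠ 0 := by
  have h : fourierMatrix n * Matrix.of (fun a x => ZMod.stdAddChar (-(a * x))) =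
      (n : ℂ) • (1 : Matrix (ZMod n) (ZMod n) ℂ) := by
    ext x y
    have hs := AddChar.sum_mulShift (x - y) (ZMod.isPrimitive_stdAddChar n)
    simp only [Matrix.mul_apply, fourierMatrix, Matrix.of_apply, ← AddChar.map_add_eq_mul,
      Matrix.smul_apply, Matrix.one_apply, smul_eq_mul]
    rw [Finset.sum_congr rfl fun a _ => by
      rw [show x * a + -(a * y) = a * (x - y) by ring], hs]
    simp [sub_eq_zero, ZMod.card]
  intro h0
  have := congrArg Matrix.det h
  rw [Matrix.det_mul, h0, zero_mul, Matrix.det_smul, Matrix.det_one, mul_one] at this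
  exact pow_ne_zero _ (Nat.cast_ne_zero.mpr (NeZero.ne n)) this.symm

lemma ZMod.one_ne_zero_and_two_ne_zero {n : ℕ} (hn : 3 ≤ n) :
    (1 : ZMod n) ≠ 0 ∧ (2 : ZMod n) ≠ 0 := by
  constructor
  · intro h
    have := (ZMod.natCast_eq_zero_iff 1 n).mp (by exact_mod_cast h)
    exact absurd (Nat.le_of_dvd one_pos this) (by omega)
  · intro h
    have := (ZMod.natCast_eq_zero_iff 2 n).mp (by exact_mod_cast h)
    exact absurd (Nat.le_of_dvd two_pos this) (by omega)

section sqTriTorus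

variable {n m : ℕ} [NeZero n] [NeZero m]

lemma sqTriTorus_neighborFinset_false (hn : 3 ≤ n) [DecidableRel (sqTriTorus n m).Adj]
    (x : ZMod n) (y : ZMod m) :
    (sqTriTorus n m).neighborFinset (x, y, false) =
      {(x, y, true), (x, y - 1, true), (x + 1, y, false), (x - 1, y, false),
        (x + 1, y, true)} := by
  obtain ⟨h1, -⟩ := ZMod.one_ne_zero_and_two_ne_zero hn
  ext ⟨x', y', s⟩
  have e1 : x = x' + 1 ↔ x' = x - 1 := by grind
  have e2 : x = x' - 1 ↔ x' = x + 1 := by grind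
  rw [SimpleGraph.mem_neighborFinset]
  cases s <;> simp [sqTriTorus] <;> grind

lemma sqTriTorus_neighborFinset_true (hn : 3 ≤ n) [DecidableRel (sqTriTorus n m).Adj]
    (x : ZMod n) (y : ZMod m) :
    (sqTriTorus n m).neighborFinset (x, y, true) =
      {(x, y, false), (x, y + 1, false), (x + 1, y, true), (x - 1, y, true),
        (x - 1, y, false)} := by
  obtain ⟨h1, -⟩ := ZMod.one_ne_zero_and_two_ne_zero hn
  ext ⟨x', y', s⟩
  have e1 : x = x' + 1 ↔ x' = x - 1 := by grind
  have e3 : y = y' - 1 ↔ y' = y + 1 := by grind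
  rw [SimpleGraph.mem_neighborFinset]
  cases s <;> simp [sqTriTorus] <;> grind

lemma sum_neighborFinset_sqTriTorus_false (hn : 3 ≤ n) (hm : 3 ≤ m)
    [DecidableRel (sqTriTorus n m).Adj] (x : ZMod n) (y : ZMod m)
    (f : ZMod n × ZMod m × Bool → ℂ) :
    ∑ v ∈ (sqTriTorus n m).neighborFinset (x, y, false), f v =
      f (x, y, true) + f (x, y - 1, true) + f (x + 1, y, false) + f (x - 1, y, false) +
        f (x + 1, y, true) := by
  obtain ⟨h1, h2⟩ := ZMod.one_ne_zero_and_two_ne_zero hn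
  obtain ⟨h3, -⟩ := ZMod.one_ne_zero_and_two_ne_zero hm
  have h4 : x + 1 ≠ x - 1 := fun h => h2 (by linear_combination h)
  have h5 : y ≠ y - 1 := fun h => h3 (by linear_combination h)
  rw [sqTriTorus_neighborFinset_false hn]
  repeat rw [Finset.sum_insert (by simp [h1, h4, h5])]
  rw [Finset.sum_singleton]
  ring

lemma sum_neighborFinset_sqTriTorus_true (hn : 3 ≤ n) (hm : 3 ≤ m)
    [DecidableRel (sqTriTorus n m).Adj] (x : ZMod n) (y : ZMod m)
    (f : ZMod n × ZMod m × Bool → ℂ) :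
    ∑ v ∈ (sqTriTorus n m).neighborFinset (x, y, true), f v =
      f (x, y, false) + f (x, y + 1, false) + f (x + 1, y, true) + f (x - 1, y, true) +
        f (x - 1, y, false) := by
  obtain ⟨h1, h2⟩ := ZMod.one_ne_zero_and_two_ne_zero hn
  obtain ⟨h3, -⟩ := ZMod.one_ne_zero_and_two_ne_zero hm
  have h4 : x + 1 ≠ x - 1 := fun h => h2 (by linear_combination h)
  have h5 : x ≠ x - 1 := fun h => h1 (by linear_combination h)
  rw [sqTriTorus_neighborFinset_true hn]
  repeat rw [Finset.sum_insert (by simp [h1, h3, h4, h5])]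
  rw [Finset.sum_singleton]
  ring

/-- The block of the adjacency operator of `sqTriTorus n m` at the character `(a, b)` of
`ℤ/nℤ × ℤ/mℤ`. -/
noncomputable def sqTriTorusSymbol (k : ZMod n × ZMod m) : Matrix Bool Bool ℂ :=
  Matrix.of fun s t => if s = t then ZMod.stdAddChar k.1 + ZMod.stdAddChar (-k.1)
    else if s then 1 + ZMod.stdAddChar k.2 + ZMod.stdAddChar (-k.1)
    else 1 + ZMod.stdAddChar (-k.2) + ZMod.stdAddChar k.1

/-- The character table of `ℤ/nℤ × ℤ/mℤ`, acting trivially on the two sublattices. -/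
noncomputable def sqTriTorusFourier (n m : ℕ) [NeZero n] [NeZero m] :
    Matrix (ZMod n × ZMod m × Bool) (ZMod n × ZMod m × Bool) ℂ :=
  (fourierMatrix n).kronecker ((fourierMatrix m).kronecker 1)

lemma sqTriTorusFourier_apply (u c : ZMod n × ZMod m × Bool) :
    sqTriTorusFourier n m u c = ZMod.stdAddChar (u.1 * c.1) *
      (ZMod.stdAddChar (u.2.1 * c.2.1) * if u.2.2 = c.2.2 then 1 else 0) := by
  simp [sqTriTorusFourier, fourierMatrix, Matrix.one_apply]

/-- Reordering of the index set of the block diagonal form. -/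
def sqTriTorusIndexEquiv (n m : ℕ) :
    Bool × (ZMod n × ZMod m) ≃ ZMod n × ZMod m × Bool :=
  (Equiv.prodComm _ _).trans (Equiv.prodAssoc _ _ _)

lemma adjMatrix_mul_sqTriTorusFourier (hn : 3 ≤ n) (hm : 3 ≤ m)
    [DecidableRel (sqTriTorus n m).Adj] :
    (sqTriTorus n m).adjMatrix ℂ * sqTriTorusFourier n m =
      sqTriTorusFourier n m * Matrix.reindex (sqTriTorusIndexEquiv n m)
        (sqTriTorusIndexEquiv n m) (Matrix.blockDiagonal sqTriTorusSymbol) := by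
  ext ⟨x, y, s⟩ ⟨a, b, t⟩
  rw [SimpleGraph.adjMatrix_mul_apply, Matrix.mul_apply]
  have hR : ∑ w, sqTriTorusFourier n m (x, y, s) w * Matrix.reindex (sqTriTorusIndexEquiv n m)
        (sqTriTorusIndexEquiv n m) (Matrix.blockDiagonal sqTriTorusSymbol) w (a, b, t) =
      ZMod.stdAddChar (x * a) * ZMod.stdAddChar (y * b) * sqTriTorusSymbol (a, b) s t := by
    rw [Finset.sum_eq_single (a, b, s)]
    · simp [sqTriTorusFourier_apply, sqTriTorusIndexEquiv, Matrix.blockDiagonal_apply]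
    · rintro ⟨a', b', s'⟩ - hne
      simp only [sqTriTorusFourier_apply, sqTriTorusIndexEquiv, Matrix.blockDiagonal_apply,
        Matrix.reindex_apply, Matrix.submatrix_apply]
      by_cases hs : s = s'
      · have : ¬ (a' = a ∧ b' = b) := by
          rintro ⟨rfl, rfl⟩
          exact hne (by rw [hs])
        simp [this]
      · simp [hs]
    · simp
  rw [hR]
  cases s
  · rw [sum_neighborFinset_sqTriTorus_false hn hm]
    cases t <;> simp [sqTriTorusFourier_apply, sqTriTorusSymbol, add_mul,
      sub_eq_add_neg, AddChar.map_add_eq_mul] <;> ring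
  · rw [sum_neighborFinset_sqTriTorus_true hn hm]
    cases t <;> simp [sqTriTorusFourier_apply, sqTriTorusSymbol, add_mul,
      sub_eq_add_neg, AddChar.map_add_eq_mul] <;> ring

lemma charpoly_adjMatrix_sqTriTorus (hn : 3 ≤ n) (hm : 3 ≤ m)
    [DecidableRel (sqTriTorus n m).Adj] :
    ((sqTriTorus n m).adjMatrix ℂ).charpoly =
      ∏ k : ZMod n × ZMod m, (sqTriTorusSymbol k).charpoly := by
  rw [charpoly_eq_of_mul_eq_mul _ (adjMatrix_mul_sqTriTorusFourier hn hm),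
    Matrix.charpoly_reindex, charpoly_blockDiagonal]
  rw [sqTriTorusFourier, Matrix.kronecker, Matrix.det_kronecker, Matrix.kronecker, Matrix.det_kronecker]
  simp [det_fourierMatrix_ne_zero]

end sqTriTorus

lemma three_add_cos_eq_normSq (α β : ℝ) :
    3 + 2 * Real.cos α + 2 * Real.cos β + 2 * Real.cos (α + β) =
      (1 + Real.cos α + Real.cos β) ^ 2 + (Real.sin α - Real.sin β) ^ 2 := by
  rw [Real.cos_add]
  linear_combination -Real.sin_sq_add_cos_sq α - Real.sin_sq_add_cos_sq β

lemma ZMod.stdAddChar_natCast (n : ℕ) [NeZero n] (i : ℕ) :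
    (ZMod.stdAddChar (i : ZMod n) : ℂ) =
      Real.cos (2 * π * i / n) + Real.sin (2 * π * i / n) * Complex.I := by
  have h := ZMod.stdAddChar_coe (N := n) (i : ℤ)
  rw [Int.cast_natCast, Int.cast_natCast] at h
  rw [h, Complex.ofReal_cos, Complex.ofReal_sin, ← Complex.exp_mul_I]
  congr 1
  push_cast
  ring

lemma ZMod.stdAddChar_neg_natCast (n : ℕ) [NeZero n] (i : ℕ) :
    (ZMod.stdAddChar (-(i : ZMod n)) : ℂ) =
      Real.cos (2 * π * i / n) - Real.sin (2 * π * i / n) * Complex.I := by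
  have h := ZMod.stdAddChar_coe (N := n) (-(i : ℤ))
  rw [Int.cast_neg, Int.cast_neg, Int.cast_natCast, Int.cast_natCast] at h
  rw [h, sub_eq_add_neg, ← neg_mul, ← Complex.ofReal_neg, ← Real.sin_neg, ← Real.cos_neg,
    Complex.ofReal_cos, Complex.ofReal_sin, ← Complex.exp_mul_I]
  congr 1
  push_cast
  ring

lemma charpoly_bool {R : Type*} [CommRing R] [Nontrivial R] (M : Matrix Bool Bool R) :
    M.charpoly = Polynomial.X ^ 2 - Polynomial.C (M true true + M false false) * Polynomial.X +
      Polynomial.C (M true true * M false false - M true false * M false true) := by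
  rw [← Matrix.charpoly_reindex finTwoEquiv.symm, Matrix.charpoly_fin_two, Matrix.trace_fin_two,
    Matrix.det_fin_two]
  simp [finTwoEquiv]
  ring

open Polynomial in
lemma charpoly_sqTriTorusSymbol {n m : ℕ} [NeZero n] [NeZero m] (i j : ℕ) :
    (sqTriTorusSymbol ((i : ZMod n), (j : ZMod m))).charpoly =
      ((∏ s : Bool, (X - C (2 * Real.cos (2 * π * (i : ℝ) / (n : ℝ)) +
          (if s then (1 : ℝ) else -1) *
            Real.sqrt (3 + 2 * Real.cos (2 * π * (i : ℝ) / (n : ℝ)) +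
              2 * Real.cos (2 * π * (j : ℝ) / (m : ℝ)) +
              2 * Real.cos (2 * π * (i : ℝ) / (n : ℝ) + 2 * π * (j : ℝ) / (m : ℝ))))) :
        ℝ[X]).map (algebraMap ℝ ℂ)) := by
  rw [charpoly_bool]
  simp only [sqTriTorusSymbol, Matrix.of_apply, ZMod.stdAddChar_natCast,
    ZMod.stdAddChar_neg_natCast, Fintype.prod_bool, if_true, Bool.false_eq_true, if_false,
    Bool.true_eq_false]
  set α := 2 * π * (i : ℝ) / (n : ℝ)
  set β := 2 * π * (j : ℝ) / (m : ℝ)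
  have hs := Real.sq_sqrt (show 0 ≤ 3 + 2 * Real.cos α + 2 * Real.cos β + 2 * Real.cos (α + β) by
    rw [three_add_cos_eq_normSq]; positivity)
  set r := Real.sqrt (3 + 2 * Real.cos α + 2 * Real.cos β + 2 * Real.cos (α + β))
  rw [three_add_cos_eq_normSq] at hs
  rw [show (X - C (2 * Real.cos α + 1 * r)) *
      (X - C (2 * Real.cos α + -1 * r)) =
      X ^ 2 - C (4 * Real.cos α) * X + C (4 * Real.cos α ^ 2 - r ^ 2) by
    simp only [map_add, map_sub, map_mul, map_neg, map_pow,
      map_one, map_ofNat]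
    ring, hs]
  simp only [Polynomial.map_add, Polynomial.map_sub, Polynomial.map_mul, Polynomial.map_pow,
    Polynomial.map_X, Polynomial.map_C, Complex.coe_algebraMap]
  congr 3
  · congr 1
    push_cast
    simp
    ring
  · push_cast
    simp
    ring_nf
    simp only [Complex.I_sq]
    ring

lemma ZMod.finEquiv_apply_eq_natCast (n : ℕ) [NeZero n] (i : Fin n) :
    ZMod.finEquiv n i = ((i : ℕ) : ZMod n) := by
  obtain _ | n := n
  · exact i.elim0
  · exact (Fin.cast_val_eq_self i).symm

/-- the multiset of eigenvalues of the toroidal `3³.4²` lattice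
`S^t(n,2m)` (`n, m ≥ 3`) is
`{2cos(2πi/n) ± sqrt(3 + 2cos(2πi/n) + 2cos(2πj/m) + 2cos(2πi/n + 2πj/m))}`,
over `0 ≤ i < n`, `0 ≤ j < m` and both signs. -/
theorem eigenvalues_sqTriTorus (n m : ℕ) [NeZero n] [NeZero m] (hn : 3 ≤ n) (hm : 3 ≤ m) :
    (Finset.univ.val.map fun v => graphEigenvalues (sqTriTorus n m) v) =
      (Finset.univ.val.map fun p : Fin n × Fin m × Bool =>
        2 * Real.cos (2 * π * (p.1 : ℝ) / (n : ℝ)) +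
          (if p.2.2 then (1 : ℝ) else -1) *
            Real.sqrt (3 + 2 * Real.cos (2 * π * (p.1 : ℝ) / (n : ℝ)) +
              2 * Real.cos (2 * π * (p.2.1 : ℝ) / (m : ℝ)) +
              2 * Real.cos (2 * π * (p.1 : ℝ) / (n : ℝ) + 2 * π * (p.2.1 : ℝ) / (m : ℝ)))) := by
  classical
  have hcp : ((sqTriTorus n m).adjMatrix ℝ).charpoly = ∏ p : Fin n × Fin m × Bool,
      (Polynomial.X - Polynomial.C (2 * Real.cos (2 * π * (p.1 : ℝ) / (n : ℝ)) +
          (if p.2.2 then (1 : ℝ) else -1) *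
            Real.sqrt (3 + 2 * Real.cos (2 * π * (p.1 : ℝ) / (n : ℝ)) +
              2 * Real.cos (2 * π * (p.2.1 : ℝ) / (m : ℝ)) +
              2 * Real.cos (2 * π * (p.1 : ℝ) / (n : ℝ) + 2 * π * (p.2.1 : ℝ) / (m : ℝ))))) := by
    apply Polynomial.map_injective (algebraMap ℝ ℂ) (algebraMap ℝ ℂ).injective
    have hmap : ((sqTriTorus n m).adjMatrix ℝ).map (algebraMap ℝ ℂ) =
        (sqTriTorus n m).adjMatrix ℂ := by
      ext u v
      simp [SimpleGraph.adjMatrix_apply, apply_ite]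
    rw [← Matrix.charpoly_map, hmap, charpoly_adjMatrix_sqTriTorus hn hm, Fintype.prod_prod_type,
      Fintype.prod_prod_type, Polynomial.map_prod]
    refine (Fintype.prod_equiv (ZMod.finEquiv n).toEquiv _ _ fun i => ?_).symm
    rw [Fintype.prod_prod_type, Polynomial.map_prod]
    refine Fintype.prod_equiv (ZMod.finEquiv m).toEquiv _ _ fun j => ?_
    rw [RingEquiv.toEquiv_eq_coe, RingEquiv.toEquiv_eq_coe, EquivLike.coe_coe, EquivLike.coe_coe,
      ZMod.finEquiv_apply_eq_natCast, ZMod.finEquiv_apply_eq_natCast, charpoly_sqTriTorusSymbol]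
  have hroots := congrArg Polynomial.roots hcp
  rw [(adjMatrix_isHermitian (sqTriTorus n m)).roots_charpoly_eq_eigenvalues,
    Polynomial.roots_prod _ _ (Finset.prod_ne_zero_iff.mpr fun _ _ => Polynomial.X_sub_C_ne_zero _)]
    at hroots
  simp only [Polynomial.roots_X_sub_C, Multiset.bind_singleton] at hroots
  rw [← hroots]
  refine Multiset.map_congr rfl fun v _ => ?_
  simp only [graphEigenvalues, Function.comp_apply, RCLike.ofReal_real_eq_id, id]
end
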